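/- arXiv:2305.02864 — 3 statements merged into one kernel-verified Lean document; each statement's English description precedes it below -/
import Mathlib

section
/- Let n ≥ 2 and let K, L ∈ 𝒦ⁿ be convex bodies with K ⊆ L, with section volume CDFs G_K, G_L and mean widths b̄(K), b̄(L). Then for every z ∈ ℝ, G_L(z) ≤ G_K(z) · (b̄(K)/b̄(L)) + (1 − b̄(K)/b̄(L)). -/
open MeasureTheory Set Pointwise
open scoped RealInnerProductSpace NNReal ENNReal

noncomputable section

abbrev Euc (n : ℕ) := EuclideanSpace ℝ (Fin n)

/-- The unit sphere `S^{n-1}` in `ℝⁿ`. -/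
def unitSphere (n : ℕ) : Set (Euc n) := {θ | ‖θ‖ = 1}

/-- The upper hemisphere `S₊^{n-1}`: unit vectors whose last coordinate is nonnegative. -/
def upperHemi (n : ℕ) : Set (Euc n) :=
  {θ | ‖θ‖ = 1 ∧ ∀ i : Fin n, (i : ℕ) = n - 1 → 0 ≤ θ i}

/-- The hyperplane `T_{θ,s} = {x : ⟨x,θ⟩ = s}`. -/
def hyperplane {n : ℕ} (θ : Euc n) (s : ℝ) : Set (Euc n) := {x | ⟪x, θ⟫ = s}

/-- Spherical Lebesgue measure, realized as the `(n-1)`-dimensional Hausdorff measure. -/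
def sphMeasure (n : ℕ) : Measure (Euc n) := μH[(n : ℝ) - 1]

/-- `vol_{n-1}(K ∩ T_{θ,s})`. -/
def sectionVolume {n : ℕ} (K : Set (Euc n)) (θ : Euc n) (s : ℝ) : ℝ :=
  (μH[(n : ℝ) - 1] (K ∩ hyperplane θ s)).toReal

/-- `μ([K])`. -/
def muBracket {n : ℕ} (K : Set (Euc n)) : ℝ :=
  ∫ θ in upperHemi n,
    (∫ s : ℝ, Set.indicator {s : ℝ | (K ∩ hyperplane θ s).Nonempty} (fun _ => (1 : ℝ)) s)
    ∂ sphMeasure n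

/-- The section volume CDF `G_K`. -/
def sectionCDF {n : ℕ} (K : Set (Euc n)) (z : ℝ) : ℝ :=
  (1 / muBracket K) *
    ∫ θ in upperHemi n,
      (∫ s : ℝ, Set.indicator
          {s : ℝ | sectionVolume K θ s ≤ z ∧ (K ∩ hyperplane θ s).Nonempty}
          (fun _ => (1 : ℝ)) s)
      ∂ sphMeasure n

/-- A convex body: a compact convex set with nonempty interior. -/
structure IsConvexBody {n : ℕ} (K : Set (Euc n)) : Prop where
  convex : Convex ℝ K
  isCompact : IsCompact K
  interiorNonempty : (interior K).Nonempty


/-- `f_θ(s) = vol_{n-1}(K ∩ T_{θ,s})^{1/(n-1)}`. -/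
def fTheta {n : ℕ} (K : Set (Euc n)) (θ : Euc n) (s : ℝ) : ℝ :=
  sectionVolume K θ s ^ ((1 : ℝ) / ((n : ℝ) - 1))

/-- The inner section function `m_K(θ) = max_s vol_{n-1}(K ∩ T_{θ,s})`. -/
def innerSection {n : ℕ} (K : Set (Euc n)) (θ : Euc n) : ℝ :=
  ⨆ s : ℝ, sectionVolume K θ s

/-- A CDF `G` is absolutely continuous w.r.t. Lebesgue measure if it admits a Lebesgue
density, i.e. `G z = ∫_{-∞}^z g(t) dt` for some nonnegative `g`. -/
def IsAbsolutelyContinuousCDF (G : ℝ → ℝ) : Prop :=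
  ∃ g : ℝ → ℝ, (∀ t, 0 ≤ g t) ∧ ∀ z : ℝ, G z = ∫ t in Set.Iic z, g t

/-- The width of `K` in direction `θ`: the length of the orthogonal projection of `K` on the
line through the origin with direction `θ`. -/
def width {n : ℕ} (K : Set (Euc n)) (θ : Euc n) : ℝ :=
  sSup ((fun x => ⟪x, θ⟫) '' K) - sInf ((fun x => ⟪x, θ⟫) '' K)

/-- The mean width `b̄(K)`. -/
def meanWidth {n : ℕ} (K : Set (Euc n)) : ℝ :=
  (1 / (sphMeasure n (upperHemi n)).toReal) * ∫ θ in upperHemi n, width K θ ∂ sphMeasure n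

/-- A strictly convex body: a convex body such that every proper convex combination of two
distinct points of `K` lies in the interior of `K`. -/
def IsStrictlyConvexBody {n : ℕ} (K : Set (Euc n)) : Prop :=
  IsConvexBody K ∧ ∀ x ∈ K, ∀ y ∈ K, x ≠ y →
    ∀ l : ℝ, l ∈ Set.Ioo (0 : ℝ) 1 → l • x + (1 - l) • y ∈ interior K

/-- A full-dimensional convex polytope: the convex hull of finitely many points, with
nonempty interior. -/
def IsFullDimPolytope {n : ℕ} (P : Set (Euc n)) : Prop :=
  (∃ V : Finset (Euc n), P = convexHull ℝ (V : Set (Euc n))) ∧ (interior P).Nonempty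

lemma aux_key {n : ℕ} (hn : 2 ≤ n) (K : Set (Euc n)) (hK : IsCompact K) :
    ∃ g : Euc n × ℝ → ℝ≥0∞, Measurable g ∧
      ∀ θ : Euc n, ‖θ‖ = 1 → ∀ s : ℝ,
        μH[(n : ℝ) - 1] (K ∩ hyperplane θ s) = g (θ, s) ∧ g (θ, s) < ⊤ := by
  obtain ⟨m, rfl⟩ : ∃ m, n = m + 1 := ⟨n - 1, by omega⟩
  obtain ⟨e, he⟩ : ∃ e : Euc (m + 1), ‖e‖ = 1 :=
    ⟨EuclideanSpace.single (Fin.last m) (1 : ℝ), by simp⟩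
  have he0 : e ≠ 0 := by
    rintro rfl; simp at he
  have hee : ⟪e, e⟫ = (1 : ℝ) := by
    rw [real_inner_self_eq_norm_sq, he]; norm_num
  haveI : Fact (Module.finrank ℝ (Euc (m + 1)) = m + 1) := ⟨by simp⟩
  have hfr : Module.finrank ℝ (ℝ ∙ e)ᗮ = m := Submodule.finrank_orthogonal_span_singleton he0
  have hdim : ((m + 1 : ℕ) : ℝ) - 1 = (Module.finrank ℝ (ℝ ∙ e)ᗮ : ℝ) := by
    rw [hfr]; push_cast; ring
  rw [hdim]
  set E' := (ℝ ∙ e)ᗮ with hE'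
  let ν : Measure E' := μH[(Module.finrank ℝ E' : ℝ)]
  let R : Euc (m + 1) → (Euc (m + 1) ≃ₗᵢ[ℝ] Euc (m + 1)) :=
    fun θ => (ℝ ∙ (θ - e))ᗮ.reflection
  have hRf : ∀ θ x, R θ x = -((2 : ℝ) • (⟪θ - e, x⟫ / (‖θ - e‖ ^ 2)) • (θ - e) - x) := by
    intro θ x
    simp only [R]
    rw [Submodule.reflection_orthogonal_apply, Submodule.reflection_singleton_apply]
    simp [two_smul]
  let Φ : (Euc (m + 1) × ℝ) × E' → Euc (m + 1) :=
    fun q => R q.1.1 ((q.2 : Euc (m + 1)) + q.1.2 • e)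
  have hΦ : Measurable Φ := by
    simp only [Φ, hRf]
    fun_prop
  refine ⟨fun p => ν (Prod.mk p ⁻¹' (Φ ⁻¹' K)), ?_, ?_⟩
  · exact measurable_measure_prodMk_left (hΦ hK.measurableSet)
  intro θ hθ s
  have hRR : ∀ x, R θ (R θ x) = x := fun x => Submodule.reflection_reflection _ x
  have hRθ : R θ θ = e := Submodule.reflection_sub (by rw [hθ, he])
  have hRe : R θ e = θ := by rw [← hRθ, hRR]
  have hiso : Isometry (fun w : E' => Φ ((θ, s), w)) := by
    apply Isometry.of_dist_eq
    intro x y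
    simp only [Φ, LinearIsometryEquiv.dist_map, dist_add_right]
    rfl
  have him : K ∩ hyperplane θ s = (fun w : E' => Φ ((θ, s), w)) '' (Prod.mk (θ, s) ⁻¹' (Φ ⁻¹' K)) := by
    ext x
    constructor
    · rintro ⟨hx, hxs⟩
      have hxs' : ⟪x, θ⟫ = s := hxs
      have hw : R θ x - s • e ∈ E' := by
        rw [hE', Submodule.mem_orthogonal_singleton_iff_inner_left]
        rw [inner_sub_left, inner_smul_left, hee]
        have : ⟪R θ x, e⟫ = s := by
          rw [← hRθ, LinearIsometryEquiv.inner_map_map, hxs']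
        rw [this]; simp
      have hΦx : Φ ((θ, s), ⟨R θ x - s • e, hw⟩) = x := by
        simp [Φ, hRR]
      refine ⟨⟨R θ x - s • e, hw⟩, ?_, hΦx⟩
      change Φ ((θ, s), ⟨R θ x - s • e, hw⟩) ∈ K
      rw [hΦx]; exact hx
    · rintro ⟨w, hw, rfl⟩
      refine ⟨hw, ?_⟩
      change ⟪R θ ((w : Euc (m + 1)) + s • e), θ⟫ = s
      have hwe : ⟪(w : Euc (m + 1)), e⟫ = (0 : ℝ) :=
        Submodule.mem_orthogonal_singleton_iff_inner_left.mp w.2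
      conv_lhs => rw [← hRe]
      rw [hRe]
      nth_rewrite 2 [← hRe]
      rw [LinearIsometryEquiv.inner_map_map, inner_add_left, inner_smul_left, hwe, hee]
      simp
  constructor
  · rw [him, hiso.hausdorffMeasure_image (Or.inl (by positivity))]
  · have hc : IsCompact (Prod.mk (θ, s) ⁻¹' (Φ ⁻¹' K) : Set E') :=
      hiso.isClosedEmbedding.isCompact_preimage hK
    exact hc.measure_lt_top

lemma aux_N {n : ℕ} (K : Set (Euc n)) (θ : Euc n) :
    {s : ℝ | (K ∩ hyperplane θ s).Nonempty} = (fun x => ⟪x, θ⟫) '' K := by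
  ext s
  simp only [hyperplane, Set.Nonempty, mem_setOf_eq, mem_inter_iff, mem_image]

lemma aux_compact {n : ℕ} {K : Set (Euc n)} (hK : IsConvexBody K) (θ : Euc n) :
    IsCompact ((fun x : Euc n => ⟪x, θ⟫) '' K) :=
  hK.isCompact.image (by fun_prop)

lemma aux_width {n : ℕ} {K : Set (Euc n)} (hK : IsConvexBody K) (θ : Euc n) :
    volume.real ((fun x : Euc n => ⟪x, θ⟫) '' K) = width K θ := by
  have hne : K.Nonempty := hK.interiorNonempty.mono interior_subset
  have hconn : IsConnected ((fun x : Euc n => ⟪x, θ⟫) '' K) :=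
    (hK.convex.isConnected hne).image _ (by fun_prop)
  have h := eq_Icc_of_connected_compact hconn (aux_compact hK θ)
  have hle : sInf ((fun x : Euc n => ⟪x, θ⟫) '' K) ≤ sSup ((fun x : Euc n => ⟪x, θ⟫) '' K) :=
    Real.sInf_le_sSup _ (aux_compact hK θ).bddBelow (aux_compact hK θ).bddAbove
  unfold width
  conv_lhs => rw [h]
  rw [Real.volume_real_Icc_of_le hle]

lemma aux_closed {n : ℕ} {K : Set (Euc n)} (hK : IsCompact K) :
    IsClosed {p : Euc n × ℝ | (K ∩ hyperplane p.1 p.2).Nonempty} := by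
  have h1 : {p : Euc n × ℝ | (K ∩ hyperplane p.1 p.2).Nonempty} =
      Prod.snd '' ((K ×ˢ univ) ∩ {q : Euc n × (Euc n × ℝ) | ⟪q.1, q.2.1⟫ = q.2.2}) := by
    ext ⟨θ, s⟩
    simp [hyperplane, Set.Nonempty]
  have h2 : {p : Euc n × ℝ | (K ∩ hyperplane p.1 p.2).Nonempty} =
      Prod.snd '' {q : K × (Euc n × ℝ) | ⟪(q.1 : Euc n), q.2.1⟫ = q.2.2} := by
    ext ⟨θ, s⟩
    simp [hyperplane, Set.Nonempty]
  rw [h2]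
  haveI : CompactSpace K := isCompact_iff_compactSpace.mp hK
  apply isClosedMap_snd_of_compactSpace
  exact isClosed_eq (by fun_prop) (by fun_prop)

lemma aux_hemi (n : ℕ) : MeasurableSet (upperHemi n) := by
  apply IsClosed.measurableSet
  have : upperHemi n = {θ : Euc n | ‖θ‖ = 1} ∩
      ⋂ i : Fin n, ⋂ _ : (i : ℕ) = n - 1, {θ : Euc n | 0 ≤ θ i} := by
    ext θ; simp [upperHemi]
  rw [this]
  refine (isClosed_eq (by fun_prop) (by fun_prop)).inter ?_
  refine isClosed_iInter fun i => isClosed_iInter fun _ => ?_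
  exact isClosed_le (by fun_prop) (by fun_prop)

def auxS {n : ℕ} (K : Set (Euc n)) (z : ℝ) (θ : Euc n) : Set ℝ :=
  {s : ℝ | sectionVolume K θ s ≤ z ∧ (K ∩ hyperplane θ s).Nonempty}

lemma aux_S {n : ℕ} (hn : 2 ≤ n) {K : Set (Euc n)} (hK : IsCompact K) (z : ℝ) :
    ∃ A : Set (Euc n × ℝ), MeasurableSet A ∧ ∀ θ : Euc n, ‖θ‖ = 1 →
      auxS K z θ = Prod.mk θ ⁻¹' A := by
  obtain ⟨g, hg, hgK⟩ := aux_key hn K hK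
  refine ⟨{p | (g p).toReal ≤ z} ∩ {p | (K ∩ hyperplane p.1 p.2).Nonempty},
    (measurableSet_le hg.ennreal_toReal measurable_const).inter (aux_closed hK).measurableSet, ?_⟩
  intro θ hθ
  ext s
  simp [auxS, sectionVolume, (hgK θ hθ s).1]

lemma aux_S_meas {n : ℕ} (hn : 2 ≤ n) {K : Set (Euc n)} (hK : IsCompact K) (z : ℝ)
    (θ : Euc n) (hθ : ‖θ‖ = 1) : MeasurableSet (auxS K z θ) := by
  obtain ⟨A, hA, h⟩ := aux_S hn hK z
  rw [h θ hθ]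
  exact measurable_prodMk_left hA

lemma aux_F_meas {n : ℕ} (hn : 2 ≤ n) {K : Set (Euc n)} (hK : IsCompact K) (z : ℝ) :
    AEStronglyMeasurable (fun θ => volume.real (auxS K z θ))
      ((sphMeasure n).restrict (upperHemi n)) := by
  obtain ⟨A, hA, h⟩ := aux_S hn hK z
  have hm : Measurable (fun θ : Euc n => (volume (Prod.mk θ ⁻¹' A)).toReal) :=
    (measurable_measure_prodMk_left hA).ennreal_toReal
  refine hm.aestronglyMeasurable.congr ?_
  filter_upwards [ae_restrict_mem (aux_hemi n)] with θ hθ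
  rw [h θ hθ.1, Measure.real]

lemma aux_w_meas {n : ℕ} {K : Set (Euc n)} (hK : IsConvexBody K) :
    Measurable (width K) := by
  have hm : Measurable (fun θ : Euc n =>
      (volume (Prod.mk θ ⁻¹' {p : Euc n × ℝ | (K ∩ hyperplane p.1 p.2).Nonempty})).toReal) :=
    (measurable_measure_prodMk_left (aux_closed hK.isCompact).measurableSet).ennreal_toReal
  convert hm using 2 with θ
  rw [← aux_width hK, ← aux_N, Measure.real]
  rfl

lemma aux_mu {n : ℕ} {K : Set (Euc n)} (hK : IsConvexBody K) :
    muBracket K = ∫ θ in upperHemi n, width K θ ∂ sphMeasure n := by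
  unfold muBracket
  congr 1
  ext θ
  rw [aux_N, ← aux_width hK]
  exact integral_indicator_one (aux_compact hK θ).measurableSet

lemma aux_cdf {n : ℕ} (hn : 2 ≤ n) {K : Set (Euc n)} (hK : IsConvexBody K) (z : ℝ) :
    sectionCDF K z = (1 / muBracket K) *
      ∫ θ in upperHemi n, volume.real (auxS K z θ) ∂ sphMeasure n := by
  unfold sectionCDF
  congr 1
  refine setIntegral_congr_fun (aux_hemi n) ?_
  intro θ hθ
  exact integral_indicator_one (aux_S_meas hn hK.isCompact z θ hθ.1)

lemma aux_vol_mono {n : ℕ} (hn : 2 ≤ n) {K L : Set (Euc n)} (hL : IsCompact L) (hKL : K ⊆ L)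
    (θ : Euc n) (hθ : ‖θ‖ = 1) (s : ℝ) : sectionVolume K θ s ≤ sectionVolume L θ s := by
  obtain ⟨g, hg, hgL⟩ := aux_key hn L hL
  refine ENNReal.toReal_mono ?_ (measure_mono (inter_subset_inter_left _ hKL))
  rw [(hgL θ hθ s).1]
  exact (hgL θ hθ s).2.ne

lemma aux_S_sub {n : ℕ} (K : Set (Euc n)) (z : ℝ) (θ : Euc n) :
    auxS K z θ ⊆ (fun x : Euc n => ⟪x, θ⟫) '' K := by
  rw [← aux_N]
  exact fun s hs => hs.2

lemma aux_F_le {n : ℕ} {K : Set (Euc n)} (hK : IsConvexBody K) (z : ℝ) (θ : Euc n) :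
    volume.real (auxS K z θ) ≤ width K θ := by
  rw [← aux_width hK]
  exact measureReal_mono (aux_S_sub K z θ) (aux_compact hK θ).measure_lt_top.ne

lemma aux_w_mono {n : ℕ} {K L : Set (Euc n)} (hK : IsConvexBody K) (hL : IsConvexBody L)
    (hKL : K ⊆ L) (θ : Euc n) : width K θ ≤ width L θ := by
  rw [← aux_width hK, ← aux_width hL]
  exact measureReal_mono (image_mono hKL) (aux_compact hL θ).measure_lt_top.ne

lemma aux_pt {n : ℕ} (hn : 2 ≤ n) {K L : Set (Euc n)} (hK : IsConvexBody K) (hL : IsConvexBody L)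
    (hKL : K ⊆ L) (z : ℝ) (θ : Euc n) (hθ : ‖θ‖ = 1) :
    volume.real (auxS L z θ) + width K θ ≤ volume.real (auxS K z θ) + width L θ := by
  rw [← aux_width hK, ← aux_width hL]
  have hLf := ((aux_compact hL θ).measure_lt_top (μ := volume)).ne
  have hKf := ((aux_compact hK θ).measure_lt_top (μ := volume)).ne
  rw [← measureReal_union_add_inter (aux_compact hK θ).measurableSet
    (measure_ne_top_of_subset (aux_S_sub L z θ) hLf) hKf, add_comm]
  refine add_le_add (measureReal_mono ?_ (measure_ne_top_of_subset (aux_S_sub K z θ) hKf))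
    (measureReal_mono (union_subset (aux_S_sub L z θ) (image_mono hKL)) hLf)
  rw [← aux_N]
  rintro s ⟨hs, hs'⟩
  exact ⟨(aux_vol_mono hn hL.isCompact hKL θ hθ s).trans hs.1, hs'⟩

/-- inclusion: if `K ⊆ L` then
`G_L(z) ≤ G_K(z)·(b̄(K)/b̄(L)) + (1 − b̄(K)/b̄(L))`. -/
theorem sectionCDF_inclusion {n : ℕ} (hn : 2 ≤ n)
    (K L : Set (Euc n)) (hK : IsConvexBody K) (hL : IsConvexBody L) (hKL : K ⊆ L) (z : ℝ) :
    sectionCDF L z ≤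
      sectionCDF K z * (meanWidth K / meanWidth L) + (1 - meanWidth K / meanWidth L) := by
  have hw0 : ∀ {M : Set (Euc n)}, IsConvexBody M → ∀ θ, 0 ≤ width M θ := fun hM θ => by
    rw [← aux_width hM]; exact measureReal_nonneg
  by_cases hint : Integrable (width L) ((sphMeasure n).restrict (upperHemi n))
  swap
  · have h0 : ∫ θ in upperHemi n, width L θ ∂ sphMeasure n = 0 := integral_undef hint
    have h1 : sectionCDF L z = 0 := by rw [aux_cdf hn hL, aux_mu hL, h0]; simp
    have h2 : meanWidth L = 0 := by rw [meanWidth, h0]; simp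
    rw [h1, h2]; simp
  have hintK : Integrable (width K) ((sphMeasure n).restrict (upperHemi n)) :=
    hint.mono' (aux_w_meas hK).aestronglyMeasurable
      (Filter.Eventually.of_forall fun θ => by
        rw [Real.norm_of_nonneg (hw0 hK θ)]; exact aux_w_mono hK hL hKL θ)
  have hFK : Integrable (fun θ => volume.real (auxS K z θ))
      ((sphMeasure n).restrict (upperHemi n)) :=
    hintK.mono' (aux_F_meas hn hK.isCompact z)
      (Filter.Eventually.of_forall fun θ => by
        rw [Real.norm_of_nonneg measureReal_nonneg]; exact aux_F_le hK z θ)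
  have hFL : Integrable (fun θ => volume.real (auxS L z θ))
      ((sphMeasure n).restrict (upperHemi n)) :=
    hint.mono' (aux_F_meas hn hL.isCompact z)
      (Filter.Eventually.of_forall fun θ => by
        rw [Real.norm_of_nonneg measureReal_nonneg]; exact aux_F_le hL z θ)
  have hmain : (∫ θ in upperHemi n, volume.real (auxS L z θ) ∂ sphMeasure n) +
      (∫ θ in upperHemi n, width K θ ∂ sphMeasure n) ≤
      (∫ θ in upperHemi n, volume.real (auxS K z θ) ∂ sphMeasure n) +
      (∫ θ in upperHemi n, width L θ ∂ sphMeasure n) := by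
    rw [← integral_add hFL hintK, ← integral_add hFK hint]
    refine setIntegral_mono_on (hFL.add hintK) (hFK.add hint) (aux_hemi n) ?_
    intro θ hθ
    exact aux_pt hn hK hL hKL z θ hθ.1
  have hLle : (∫ θ in upperHemi n, volume.real (auxS L z θ) ∂ sphMeasure n) ≤
      (∫ θ in upperHemi n, width L θ ∂ sphMeasure n) :=
    integral_mono hFL hint (aux_F_le hL z)
  have hWK0 : 0 ≤ ∫ θ in upperHemi n, width K θ ∂ sphMeasure n := integral_nonneg (hw0 hK)
  have hWL0 : 0 ≤ ∫ θ in upperHemi n, width L θ ∂ sphMeasure n := integral_nonneg (hw0 hL)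
  rw [aux_cdf hn hL, aux_cdf hn hK, aux_mu hL, aux_mu hK, meanWidth, meanWidth]
  generalize (∫ θ in upperHemi n, volume.real (auxS L z θ) ∂ sphMeasure n) = FL at *
  generalize (∫ θ in upperHemi n, volume.real (auxS K z θ) ∂ sphMeasure n) = FK at *
  generalize (∫ θ in upperHemi n, width L θ ∂ sphMeasure n) = WL at *
  generalize (∫ θ in upperHemi n, width K θ ∂ sphMeasure n) = WK at *
  generalize (sphMeasure n (upperHemi n)).toReal = a at *
  have hone : 1 / WL * FL ≤ 1 := by
    rw [one_div_mul_eq_div]; exact div_le_one_of_le₀ hLle hWL0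
  rcases eq_or_ne a 0 with rfl | ha
  · simpa using hone
  have hr : 1 / a * WK / (1 / a * WL) = WK / WL := by
    rw [mul_div_mul_left]; simpa using ha
  rw [hr]
  rcases hWL0.eq_or_lt with h | hL0
  · subst h; simp
  rcases hWK0.eq_or_lt with h | hK0
  · subst h; simpa using hone
  have e : 1 / WK * FK * (WK / WL) + (1 - WK / WL) = (FK + WL - WK) / WL := by
    field_simp
    ring
  rw [e, one_div_mul_eq_div]
  gcongr
  linarith
end
end

section
/- Let n ≥ 2 and K ∈ 𝒦ⁿ a convex body. For θ ∈ S^{n-1} define f_θ : ℝ → [0,∞) by f_θ(s) = vol_{n-1}(K ∩ T_{θ,s})^{1/(n-1)}. If for σ_{n-1}-almost all θ ∈ S₊^{n-1} the function f_θ is continuous on ℝ and attains its maximum at a unique point, then the section volume CDF G_K is absolutely continuous with respect to Lebesgue measure. -/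
open MeasureTheory Set Pointwise
open scoped RealInnerProductSpace NNReal ENNReal

noncomputable section

theorem bm1_compact {A B C : Set ℝ} {p q : ℝ} (hp : 0 < p) (hq : 0 < q)
    (hA : IsCompact A) (hB : IsCompact B) (hA0 : A.Nonempty) (hB0 : B.Nonempty)
    (h : ∀ x ∈ A, ∀ y ∈ B, p * x + q * y ∈ C) :
    ENNReal.ofReal p * volume A + ENNReal.ofReal q * volume B ≤ volume C := by
  obtain ⟨a, ha, ha'⟩ := hA.exists_isGreatest hA0
  obtain ⟨b, hb, hb'⟩ := hB.exists_isLeast hB0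
  have e1 : volume ((q * b) +ᵥ (p • A)) = ENNReal.ofReal p * volume A := by
    rw [measure_vadd, Measure.addHaar_smul]; simp [abs_of_pos hp]
  have e2 : volume ((p * a) +ᵥ (q • B)) = ENNReal.ofReal q * volume B := by
    rw [measure_vadd, Measure.addHaar_smul]; simp [abs_of_pos hq]
  rw [← e1, ← e2, ← measure_union₀]
  · apply measure_mono
    rintro x (⟨y, ⟨z, hz, rfl⟩, rfl⟩ | ⟨y, ⟨z, hz, rfl⟩, rfl⟩)
    · have := h z hz b hb
      simpa [add_comm] using this
    · exact h a ha z hz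
  · exact ((hB.smul q).vadd (p * a)).measurableSet.nullMeasurableSet
  · have : ((q * b) +ᵥ (p • A)) ∩ ((p * a) +ᵥ (q • B)) ⊆ {p * a + q * b} := by
      rintro x ⟨⟨y, ⟨z, hz, rfl⟩, rfl⟩, ⟨y', ⟨z', hz', rfl⟩, h2⟩⟩
      simp only [smul_eq_mul, vadd_eq_add, mem_singleton_iff] at h2 ⊢
      have h3 : p * z ≤ p * a := mul_le_mul_of_nonneg_left (ha' hz) hp.le
      have h4 : q * b ≤ q * z' := mul_le_mul_of_nonneg_left (hb' hz') hq.le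
      linarith
    exact measure_mono_null this (by simp)

theorem bm1 {A B C : Set ℝ} {p q : ℝ} (hp : 0 < p) (hq : 0 < q)
    (hA : MeasurableSet A) (hB : MeasurableSet B) (hA0 : A.Nonempty) (hB0 : B.Nonempty)
    (h : ∀ x ∈ A, ∀ y ∈ B, p * x + q * y ∈ C) :
    ENNReal.ofReal p * volume A + ENNReal.ofReal q * volume B ≤ volume C := by
  obtain ⟨a, ha⟩ := hA0
  obtain ⟨b, hb⟩ := hB0
  have key : ∀ A' ⊆ A, IsCompact A' → ∀ B' ⊆ B, IsCompact B' →
      ENNReal.ofReal p * volume A' + ENNReal.ofReal q * volume B' ≤ volume C := by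
    intro A' hA' cA B' hB' cB
    refine le_trans ?_ (bm1_compact hp hq (cA.insert a) (cB.insert b) (by simp) (by simp) ?_)
    · gcongr <;> exact subset_insert _ _
    · rintro x hx y hy
      exact h x (insert_subset ha hA' hx) y (insert_subset hb hB' hy)
  have key2 : ∀ A' ⊆ A, IsCompact A' →
      ENNReal.ofReal p * volume A' + ENNReal.ofReal q * volume B ≤ volume C := by
    intro A' hA' cA
    rw [hB.measure_eq_iSup_isCompact, ENNReal.mul_iSup, ENNReal.add_iSup]
    refine iSup_le fun B' => ?_
    by_cases h1 : B' ⊆ B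
    · by_cases h2 : IsCompact B'
      · simpa [h1, h2] using key A' hA' cA B' h1 h2
      · simpa [h1, h2] using key A' hA' cA ∅ (by simp) (by simp)
    · simpa [h1] using key A' hA' cA ∅ (by simp) (by simp)
  rw [hA.measure_eq_iSup_isCompact, ENNReal.mul_iSup, ENNReal.iSup_add]
  refine iSup_le fun A' => ?_
  by_cases h1 : A' ⊆ A
  · by_cases h2 : IsCompact A'
    · simpa [h1, h2] using key2 A' h1 h2
    · simpa [h1, h2] using key2 ∅ (by simp) (by simp)
  · simpa [h1] using key2 ∅ (by simp) (by simp)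

theorem lint_trunc {f : ℝ → ℝ} (hf : Measurable f) (h0 : ∀ x, 0 ≤ f x) (h1 : ∀ x, f x ≤ 1) :
    ∫⁻ x, ENNReal.ofReal (f x) = ∫⁻ t in Ioo (0:ℝ) 1, volume {x | t < f x} := by
  rw [lintegral_eq_lintegral_meas_lt _ (ae_of_all _ h0) hf.aemeasurable]
  have : Ioi (0:ℝ) = Ioo 0 1 ∪ Ici 1 := by ext; simp
  rw [this, lintegral_union measurableSet_Ici]
  · rw [setLIntegral_congr_fun (g := fun _ => 0) measurableSet_Ici]
    · simp
    · intro t ht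
      have : {x | t < f x} = ∅ := by
        ext x; simp only [mem_ofPred_eq, mem_empty_iff_false, iff_false, not_lt]
        exact (h1 x).trans ht
      simp [this]
  · rw [Set.disjoint_left]; rintro x hx hx'; exact absurd hx.2 (not_lt.2 hx')

theorem pl1_norm {f g h : ℝ → ℝ} {p q : ℝ} (hp : 0 < p) (hq : 0 < q)
    (hf : Measurable f) (hg : Measurable g) (hh : Measurable h)
    (f0 : ∀ x, 0 ≤ f x) (f1 : ∀ x, f x ≤ 1) (g0 : ∀ x, 0 ≤ g x) (g1 : ∀ x, g x ≤ 1)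
    (h0 : ∀ x, 0 ≤ h x)
    (fs : ∀ t < 1, ∃ x, t < f x) (gs : ∀ t < 1, ∃ x, t < g x)
    (H : ∀ t, 0 < t → ∀ x y, t < f x → t < g y → t < h (p * x + q * y)) :
    ENNReal.ofReal p * (∫⁻ x, ENNReal.ofReal (f x)) + ENNReal.ofReal q *
      (∫⁻ x, ENNReal.ofReal (g x)) ≤ ∫⁻ x, ENNReal.ofReal (h x) := by
  rw [lint_trunc hf f0 f1, lint_trunc hg g0 g1,
    lintegral_eq_lintegral_meas_lt _ (ae_of_all _ h0) hh.aemeasurable]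
  have mf : Measurable fun t => volume {x | t < f x} :=
    Antitone.measurable fun s t hst => measure_mono fun x (hx : t < f x) => hst.trans_lt hx
  rw [← lintegral_const_mul' _ _ (by simp), ← lintegral_const_mul' _ _ (by simp),
    ← lintegral_add_left (mf.const_mul _)]
  refine le_trans ?_ (lintegral_mono_set (fun t (ht : t ∈ Ioo (0:ℝ) 1) => ht.1))
  refine setLIntegral_mono_ae' measurableSet_Ioo (ae_of_all _ fun t ht => ?_)
  exact bm1 hp hq (measurableSet_lt measurable_const hf) (measurableSet_lt measurable_const hg)
    (fs t ht.2) (gs t ht.2) fun x hx y hy => H t ht.1 x y hx hy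

theorem enn_amgm {a b : ℝ≥0∞} {p q : ℝ} (hp : 0 < p) (hq : 0 < q) (hpq : p + q = 1) :
    a ^ p * b ^ q ≤ ENNReal.ofReal p * a + ENNReal.ofReal q * b := by
  by_cases ha : a = ∞
  · simp [ha, ENNReal.mul_top, hp]
  by_cases hb : b = ∞
  · simp [hb, ENNReal.mul_top, hq]
  lift a to ℝ≥0 using ha
  lift b to ℝ≥0 using hb
  have := NNReal.geom_mean_le_arith_mean2_weighted ⟨p, hp.le⟩ ⟨q, hq.le⟩ a b
    (by ext; exact hpq)
  rw [← ENNReal.coe_rpow_of_nonneg _ hp.le, ← ENNReal.coe_rpow_of_nonneg _ hq.le,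
    ENNReal.ofReal, ENNReal.ofReal, Real.toNNReal_of_nonneg hp.le, Real.toNNReal_of_nonneg hq.le]
  exact_mod_cast this

theorem pl1_bdd {f g h : ℝ → ℝ≥0∞} {p q : ℝ} (hp : 0 < p) (hq : 0 < q) (hpq : p + q = 1)
    (hf : Measurable f) (hg : Measurable g) (hh : Measurable h)
    {M : ℝ≥0∞} (hM : M ≠ ∞) (fM : ∀ x, f x ≤ M) (gM : ∀ x, g x ≤ M)
    (H : ∀ x y, f x ^ p * g y ^ q ≤ h (p * x + q * y)) :
    (∫⁻ x, f x) ^ p * (∫⁻ x, g x) ^ q ≤ ∫⁻ x, h x := by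
  set a := ⨆ x, f x with ha
  set b := ⨆ x, g x with hb
  have aT : a ≠ ∞ := ((iSup_le fM).trans_lt hM.lt_top).ne
  have bT : b ≠ ∞ := ((iSup_le gM).trans_lt hM.lt_top).ne
  have fa : ∀ x, f x ≤ a := fun x => le_iSup f x
  have gb : ∀ x, g x ≤ b := fun x => le_iSup g x
  by_cases a0 : a = 0
  · have : ∀ x, f x = 0 := fun x => le_antisymm ((fa x).trans a0.le) bot_le
    simp [this, hp]
  by_cases b0 : b = 0
  · have : ∀ x, g x = 0 := fun x => le_antisymm ((gb x).trans b0.le) bot_le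
    simp [this, hq]
  set c := a ^ p * b ^ q with hc
  have ap0 : a ^ p ≠ 0 := by simp [a0, aT]
  have bq0 : b ^ q ≠ 0 := by simp [b0, bT]
  have apT : a ^ p ≠ ∞ := ENNReal.rpow_ne_top_of_nonneg hp.le aT
  have bqT : b ^ q ≠ ∞ := ENNReal.rpow_ne_top_of_nonneg hq.le bT
  have c0 : c ≠ 0 := mul_ne_zero ap0 bq0
  have cT : c ≠ ∞ := ENNReal.mul_ne_top apT bqT
  have fT : ∀ x, f x / a ≠ ∞ := fun x => ENNReal.div_ne_top ((fa x).trans_lt aT.lt_top).ne a0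
  have gT : ∀ x, g x / b ≠ ∞ := fun x => ENNReal.div_ne_top ((gb x).trans_lt bT.lt_top).ne b0
  have hT : ∀ x, min (h x / c) 1 ≠ ∞ := fun x => by simp
  have lt_iff : ∀ (t : ℝ) (u : ℝ≥0∞), 0 < t → u ≠ ∞ → (t < u.toReal ↔ ENNReal.ofReal t < u) :=
    fun t u ht hu => (ENNReal.ofReal_lt_iff_lt_toReal ht.le hu).symm
  have f1 : ∀ x, f x / a ≤ 1 := fun x => ENNReal.div_le_of_le_mul (by simpa using fa x)
  have g1 : ∀ x, g x / b ≤ 1 := fun x => ENNReal.div_le_of_le_mul (by simpa using gb x)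
  have sup : ∀ (F : ℝ → ℝ≥0∞) (A : ℝ≥0∞), A = (⨆ x, F x) → A ≠ 0 → A ≠ ∞ → (∀ x, F x / A ≠ ∞) →
      ∀ t < 1, ∃ x, t < (F x / A).toReal := by
    intro F A hA A0 AT FT t ht
    have h1 : ENNReal.ofReal (max t 0) * A < ⨆ x, F x := by
      rw [← hA]
      calc _ < 1 * A := by
            refine ENNReal.mul_lt_mul_left A0 AT ?_
            rw [ENNReal.ofReal_lt_one]; simp [ht]
        _ = A := one_mul _
    obtain ⟨x, hx⟩ := lt_iSup_iff.1 h1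
    refine ⟨x, (le_max_left t 0).trans_lt ?_⟩
    rw [← ENNReal.ofReal_lt_iff_lt_toReal (le_max_right _ _) (FT x)]
    rwa [ENNReal.lt_div_iff_mul_lt (Or.inl A0) (Or.inl AT)]
  have key := pl1_norm (f := fun x => (f x / a).toReal) (g := fun x => (g x / b).toReal)
    (h := fun x => (min (h x / c) 1).toReal) hp hq (by fun_prop) (by fun_prop)
    (by fun_prop) (fun x => by positivity)
    (fun x => ENNReal.toReal_le_of_le_ofReal zero_le_one (by simpa using f1 x))
    (fun x => by positivity)
    (fun x => ENNReal.toReal_le_of_le_ofReal zero_le_one (by simpa using g1 x))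
    (fun x => by positivity) (sup f a rfl a0 aT fT) (sup g b rfl b0 bT gT) (by
      intro t ht x y hx hy
      rw [lt_iff _ _ ht (fT x)] at hx
      rw [lt_iff _ _ ht (gT y)] at hy
      rw [lt_iff _ _ ht (hT _), lt_min_iff]
      refine ⟨?_, hx.trans_le (f1 x)⟩
      have h1 : ENNReal.ofReal t = ENNReal.ofReal t ^ p * ENNReal.ofReal t ^ q := by
        rw [← ENNReal.rpow_add_of_nonneg _ _ hp.le hq.le, hpq, ENNReal.rpow_one]
      rw [h1]
      calc _ < (f x / a) ^ p * (g y / b) ^ q := 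
            ENNReal.mul_lt_mul (ENNReal.rpow_lt_rpow hx hp) (ENNReal.rpow_lt_rpow hy hq)
        _ = f x ^ p * g y ^ q / c := by
            rw [ENNReal.div_rpow_of_nonneg _ _ hp.le, ENNReal.div_rpow_of_nonneg _ _ hq.le, hc,
              div_eq_mul_inv, div_eq_mul_inv, div_eq_mul_inv,
              ENNReal.mul_inv (Or.inl ap0) (Or.inl apT)]
            ring
        _ ≤ _ := ENNReal.div_le_div_right (H x y) c)
  simp only [ENNReal.ofReal_toReal (fT _), ENNReal.ofReal_toReal (gT _),
    ENNReal.ofReal_toReal (hT _)] at key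
  have k2 := (enn_amgm hp hq hpq).trans (key.trans (lintegral_mono fun x => min_le_left _ _))
  simp only [div_eq_mul_inv] at k2
  rw [lintegral_mul_const _ hf, lintegral_mul_const _ hg, lintegral_mul_const _ hh,
    ENNReal.mul_rpow_of_nonneg _ _ hp.le, ENNReal.mul_rpow_of_nonneg _ _ hq.le,
    ENNReal.inv_rpow, ENNReal.inv_rpow, mul_mul_mul_comm, 
    ← ENNReal.mul_inv (Or.inl ap0) (Or.inl apT), ← hc] at k2
  have hci : c⁻¹ ≠ 0 := ENNReal.inv_ne_zero.2 cT
  have hci' : c⁻¹ ≠ ∞ := ENNReal.inv_ne_top.2 c0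
  exact (ENNReal.mul_le_mul_iff_left hci hci').1 k2

theorem pl1 {f g h : ℝ → ℝ≥0∞} {p q : ℝ} (hp : 0 < p) (hq : 0 < q) (hpq : p + q = 1)
    (hf : Measurable f) (hg : Measurable g) (hh : Measurable h)
    (H : ∀ x y, f x ^ p * g y ^ q ≤ h (p * x + q * y)) :
    (∫⁻ x, f x) ^ p * (∫⁻ x, g x) ^ q ≤ ∫⁻ x, h x := by
  have lim : ∀ F : ℝ → ℝ≥0∞, Measurable F →
      Filter.Tendsto (fun N : ℕ => ∫⁻ x, min (F x) N) Filter.atTop (nhds (∫⁻ x, F x)) := by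
    intro F hF
    refine lintegral_tendsto_of_tendsto_of_monotone (fun N => by fun_prop)
      (ae_of_all _ fun x i j hij => ?_) (ae_of_all _ fun x => ?_)
    · exact min_le_min le_rfl (by exact_mod_cast hij)
    · have := (tendsto_const_nhds (x := F x)).min ENNReal.tendsto_nat_nhds_top
      simpa using this
  by_cases f0 : ∫⁻ x, f x = 0
  · simp [f0, hp]
  by_cases g0 : ∫⁻ x, g x = 0
  · simp [g0, hq]
  have l1 := ENNReal.Tendsto.mul (((ENNReal.continuous_rpow_const (y := p)).tendsto _).comp (lim f hf))
    (Or.inl (by simp [f0, hp.le, hp, not_lt])) (((ENNReal.continuous_rpow_const (y := q)).tendsto _).comp (lim g hg))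
    (Or.inl (by simp [g0, hq.le, hq, not_lt]))
  refine le_of_tendsto' l1 fun N => ?_
  refine pl1_bdd hp hq hpq (by fun_prop) (by fun_prop) hh (M := N) (by simp) (by simp) (by simp) ?_
  intro x y
  refine le_trans ?_ (H x y)
  gcongr <;> exact min_le_left _ _

theorem piFin_symm (m : ℕ) (z : ℝ × (Fin m → ℝ)) :
    (MeasurableEquiv.piFinSuccAbove (fun _ : Fin (m+1) => ℝ) 0).symm z = Fin.cons z.1 z.2 := by
  ext i
  refine Fin.cases ?_ (fun j => ?_) i <;> simp [MeasurableEquiv.piFinSuccAbove]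

theorem measurable_cons (m : ℕ) :
    Measurable fun z : ℝ × (Fin m → ℝ) => (Fin.cons z.1 z.2 : Fin (m+1) → ℝ) := by
  have := (MeasurableEquiv.piFinSuccAbove (fun _ : Fin (m+1) => ℝ) 0).symm.measurable
  convert this using 2 with z
  exact (piFin_symm m z).symm

theorem lint_cons {m : ℕ} (F : (Fin (m+1) → ℝ) → ℝ≥0∞) (hF : Measurable F) :
    ∫⁻ x, F x = ∫⁻ t, ∫⁻ y : Fin m → ℝ, F (Fin.cons t y) := by
  have := (volume_preserving_piFinSuccAbove (fun _ : Fin (m+1) => ℝ) 0).symm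
  rw [← this.lintegral_comp hF, Measure.volume_eq_prod, lintegral_prod]
  · simp only [piFin_symm]
  · exact (hF.comp (MeasurableEquiv.measurable _)).aemeasurable

theorem pl (m : ℕ) : ∀ {f g h : (Fin m → ℝ) → ℝ≥0∞} {p q : ℝ} (_ : 0 < p) (_ : 0 < q) (_ : p + q = 1)
    (_ : Measurable f) (_ : Measurable g) (_ : Measurable h)
    (_ : ∀ x y, f x ^ p * g y ^ q ≤ h (p • x + q • y)),
    (∫⁻ x, f x) ^ p * (∫⁻ x, g x) ^ q ≤ ∫⁻ x, h x := by
  induction m with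
  | zero =>
    intro f g h p q hp hq hpq hf hg hh H
    rw [lintegral_unique, lintegral_unique, lintegral_unique]
    have h1 : (volume : Measure (Fin 0 → ℝ)) univ = 1 := by simp [volume_pi]
    have h2 : p • (default : Fin 0 → ℝ) + q • default = default := Subsingleton.elim _ _
    have h3 := H default default
    rw [h2] at h3
    simp only [h1, mul_one]
    convert h3
  | succ m ih =>
    intro f g h p q hp hq hpq hf hg hh H
    have mc := measurable_cons m
    rw [lint_cons f hf, lint_cons g hg, lint_cons h hh]
    refine pl1 hp hq hpq (hf.comp mc).lintegral_prod_right' (hg.comp mc).lintegral_prod_right'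
      (hh.comp mc).lintegral_prod_right' ?_
    intro s t
    refine ih hp hq hpq (hf.comp (mc.comp measurable_prodMk_left))
      (hg.comp (mc.comp measurable_prodMk_left)) (hh.comp (mc.comp measurable_prodMk_left)) ?_
    intro x y
    convert H (Fin.cons s x) (Fin.cons t y) using 2
    ext i
    refine Fin.cases ?_ (fun j => ?_) i <;> simp

theorem null_pre_left {φ : ℝ → ℝ} 
    (lc : ∀ s t p q : ℝ, 0 < p → 0 < q → p + q = 1 → φ s ^ p * φ t ^ q ≤ φ (p * s + q * t))
    {c : ℝ} (hc : ∀ s ≠ c, φ s < φ c) {N : Set ℝ} (hN : volume N = 0) :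
    volume {s | s < c ∧ 0 < φ s ∧ φ s ∈ N} = 0 := by
  set A : ℕ → Set ℝ := fun k => {s | s < c ∧ 0 < φ s ∧ φ s ∈ N ∧ c - s ≤ k ∧ 1 ≤ k * φ s ∧
    1 ≤ k * Real.log (φ c / φ s)} with hA
  have hsub : {s | s < c ∧ 0 < φ s ∧ φ s ∈ N} ⊆ ⋃ k, A k := by
    rintro s ⟨h1, h2, h3⟩
    have h4 : 0 < Real.log (φ c / φ s) := Real.log_pos ((one_lt_div h2).2 (hc s h1.ne))
    obtain ⟨k, hk⟩ := exists_nat_ge (max (c - s) (max (1 / φ s) (1 / Real.log (φ c / φ s))))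
    simp only [max_le_iff] at hk
    refine mem_iUnion.2 ⟨k, h1, h2, h3, hk.1, ?_, ?_⟩
    · exact (div_le_iff₀ h2).1 hk.2.1
    · exact (div_le_iff₀ h4).1 hk.2.2
  refine measure_mono_null hsub (measure_iUnion_null fun k => ?_)
  have key : ∀ s ∈ A k, ∀ s' ∈ A k, s < s' → s' - s ≤ (k:ℝ) ^ 3 * (φ s' - φ s) := by
    rintro s ⟨h1, h2, -, h4, h5, h6⟩ s' ⟨h1', -⟩ hs
    have hcs : 0 < c - s := by linarith
    have hφc : 0 < φ c := h2.trans (hc s h1.ne)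
    set q := (s' - s) / (c - s) with hq
    have hq0 : 0 < q := div_pos (by linarith) hcs
    have hq1 : q * (c - s) = s' - s := div_mul_cancel₀ _ hcs.ne'
    have hp0 : 0 < 1 - q := by
      rw [sub_pos, hq, div_lt_one hcs]; linarith
    have h7 := lc s c (1 - q) q hp0 hq0 (by ring)
    rw [show (1 - q) * s + q * c = s' by linarith] at h7
    have h8 : φ s ^ (1 - q) * φ c ^ q = φ s * Real.exp (q * Real.log (φ c / φ s)) := by
      rw [Real.rpow_sub h2, Real.rpow_one, mul_comm q, ← Real.rpow_def_of_pos (div_pos hφc h2),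
        Real.div_rpow hφc.le h2.le]
      ring
    have h9 : φ s * (q * Real.log (φ c / φ s)) ≤ φ s' - φ s := by
      have := mul_le_mul_of_nonneg_left (Real.add_one_le_exp (q * Real.log (φ c / φ s))) h2.le
      rw [← h8] at this
      linarith
    have hk : (0:ℝ) ≤ k := by positivity
    calc s' - s = q * (c - s) := hq1.symm
      _ ≤ q * k := by gcongr
      _ ≤ q * k * ((k * φ s) * (k * Real.log (φ c / φ s))) := 
          le_mul_of_one_le_right (by positivity) (one_le_mul_of_one_le_of_one_le h5 h6)
      _ = k ^ 3 * (φ s * (q * Real.log (φ c / φ s))) := by ring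
      _ ≤ _ := by gcongr
  have key2 : ∀ s ∈ A k, ∀ s' ∈ A k, |s' - s| ≤ (k:ℝ) ^ 3 * |φ s' - φ s| := by
    intro s hs s' hs'
    rcases lt_trichotomy s s' with h | h | h
    · rw [abs_of_pos (by linarith)]
      exact (key s hs s' hs' h).trans (by gcongr; exact le_abs_self _)
    · simp [h]
    · rw [abs_sub_comm, abs_sub_comm (φ s'), abs_of_pos (by linarith)]
      exact (key s' hs' s hs h).trans (by gcongr; exact le_abs_self _)
  have inj : InjOn φ (A k) := by
    intro s hs s' hs' h
    have := key2 s hs s' hs'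
    rw [h] at this
    simp only [sub_self, abs_zero, mul_zero, abs_nonpos_iff] at this
    linarith
  have lip : LipschitzOnWith ((k:ℝ≥0) ^ 3) (Function.invFunOn φ (A k)) (φ '' A k) := by
    refine LipschitzOnWith.of_dist_le_mul ?_
    rintro _ ⟨s, hs, rfl⟩ _ ⟨s', hs', rfl⟩
    rw [inj.leftInvOn_invFunOn hs, inj.leftInvOn_invFunOn hs', Real.dist_eq, Real.dist_eq]
    simpa using key2 s' hs' s hs
  have := lip.hausdorffMeasure_image_le zero_le_one
  rw [inj.leftInvOn_invFunOn.image_image, hausdorffMeasure_real] at this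
  have h0 : volume (φ '' A k) = 0 := by
    refine measure_mono_null ?_ hN
    rintro _ ⟨s, hs, rfl⟩
    exact hs.2.2.1
  simpa [h0] using this

theorem null_pre {φ : ℝ → ℝ} 
    (lc : ∀ s t p q : ℝ, 0 < p → 0 < q → p + q = 1 → φ s ^ p * φ t ^ q ≤ φ (p * s + q * t))
    {c : ℝ} (hc : ∀ s ≠ c, φ s < φ c) {N : Set ℝ} (hN : volume N = 0) :
    volume {s | 0 < φ s ∧ φ s ∈ N} = 0 := by
  have h1 := null_pre_left lc hc hN
  have h2 := null_pre_left (φ := fun s => φ (-s)) (c := -c) (N := N)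
    (fun s t p q hp hq hpq => by
      have := lc (-s) (-t) p q hp hq hpq
      rwa [show p * -s + q * -t = -(p * s + q * t) by ring] at this)
    (fun s hs => by
      simp only [neg_neg]
      exact hc _ fun h => hs (by linarith)) hN
  rw [← Measure.measure_preimage_neg volume] at h2
  refine measure_mono_null (t := _ ∪ _ ∪ {c}) ?_ (measure_union_null (measure_union_null h1 h2)
    (by simp))
  rintro s ⟨h3, h4⟩
  rcases lt_trichotomy s c with h | h | h
  · exact Or.inl (Or.inl ⟨h, h3, h4⟩)
  · exact Or.inr h
  · exact Or.inl (Or.inr ⟨by simpa using h, by simpa using h3, by simpa using h4⟩)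

/-- Lebesgue measure of the slice at first coordinate `s`. -/
def sliceVol {m : ℕ} (A : Set (Euc (m+1))) (s : ℝ) : ℝ≥0∞ :=
  volume {y : Fin m → ℝ | (WithLp.toLp 2 (Fin.cons s y : Fin (m+1) → ℝ) : Euc (m+1)) ∈ A}

theorem measurable_emb (m : ℕ) : Measurable fun z : ℝ × (Fin m → ℝ) =>
    (WithLp.toLp 2 (Fin.cons z.1 z.2 : Fin (m+1) → ℝ) : Euc (m+1)) :=
  (WithLp.measurable_toLp 2 _).comp (measurable_cons m)

theorem sliceVol_lc {m : ℕ} {A : Set (Euc (m+1))} (hA : Convex ℝ A) (hm : MeasurableSet A)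
    (s t : ℝ) {p q : ℝ} (hp : 0 < p) (hq : 0 < q) (hpq : p + q = 1) :
    sliceVol A s ^ p * sliceVol A t ^ q ≤ sliceVol A (p * s + q * t) := by
  have ms : ∀ s, MeasurableSet {y : Fin m → ℝ |
      (WithLp.toLp 2 (Fin.cons s y : Fin (m+1) → ℝ) : Euc (m+1)) ∈ A} := fun s =>
    ((measurable_emb m).comp (measurable_prodMk_left (x := s))) hm
  have := pl m (f := indicator {y : Fin m → ℝ |
      (WithLp.toLp 2 (Fin.cons s y : Fin (m+1) → ℝ) : Euc (m+1)) ∈ A} 1)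
    (g := indicator {y : Fin m → ℝ |
      (WithLp.toLp 2 (Fin.cons t y : Fin (m+1) → ℝ) : Euc (m+1)) ∈ A} 1)
    (h := indicator {y : Fin m → ℝ |
      (WithLp.toLp 2 (Fin.cons (p * s + q * t) y : Fin (m+1) → ℝ) : Euc (m+1)) ∈ A} 1)
    hp hq hpq (measurable_one.indicator (ms _)) (measurable_one.indicator (ms _))
    (measurable_one.indicator (ms _)) (by
      intro x y
      by_cases hx : (WithLp.toLp 2 (Fin.cons s x : Fin (m+1) → ℝ) : Euc (m+1)) ∈ A
      · by_cases hy : (WithLp.toLp 2 (Fin.cons t y : Fin (m+1) → ℝ) : Euc (m+1)) ∈ A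
        · have h3 := hA hx hy hp.le hq.le hpq
          have h4 : p • (WithLp.toLp 2 (Fin.cons s x : Fin (m+1) → ℝ) : Euc (m+1)) +
              q • WithLp.toLp 2 (Fin.cons t y : Fin (m+1) → ℝ) =
              WithLp.toLp 2 (Fin.cons (p * s + q * t) (p • x + q • y) : Fin (m+1) → ℝ) := by
            ext i
            refine Fin.cases ?_ (fun j => ?_) i <;> simp
          rw [h4] at h3
          simp [indicator, hx, hy, h3]
        · simp [indicator, hy, hq]
      · simp [indicator, hx, hp])
  simp only [lintegral_indicator_one (ms _)] at this
  exact this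

theorem volume_slice {m : ℕ} {A : Set (Euc (m+1))} (hm : MeasurableSet A) :
    volume A = ∫⁻ t, sliceVol A t := by
  have e := (PiLp.volume_preserving_toLp (Fin (m+1)))
  have hm' : MeasurableSet ((WithLp.toLp 2 : (Fin (m+1) → ℝ) → Euc (m+1)) ⁻¹' A) :=
    (WithLp.measurable_toLp 2 _) hm
  rw [← e.measure_preimage hm.nullMeasurableSet, ← lintegral_indicator_one hm',
    lint_cons _ (measurable_one.indicator hm')]
  refine lintegral_congr fun t => ?_
  rw [sliceVol, ← lintegral_indicator_one]
  · rfl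
  · exact ((measurable_emb m).comp (measurable_prodMk_left (x := t))) hm

theorem volume_slice_le {m : ℕ} {A : Set (Euc (m+1))} (hm : MeasurableSet A) (s : ℝ) :
    volume (A ∩ {x | x 0 ≤ s}) = ∫⁻ t in Iic s, sliceVol A t := by
  have hm2 : MeasurableSet {x : Euc (m+1) | x 0 ≤ s} := measurableSet_le (by fun_prop) (by fun_prop)
  rw [volume_slice (hm.inter hm2), ← lintegral_indicator measurableSet_Iic]
  refine lintegral_congr fun t => ?_
  by_cases h : t ≤ s
  · simp [sliceVol, indicator, h]
  · simp [sliceVol, indicator, h]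

theorem measurable_sliceVol {m : ℕ} {A : Set (Euc (m+1))} (hm : MeasurableSet A) :
    Measurable (sliceVol A) :=
  measurable_measure_prodMk_left ((measurable_emb m) hm)

theorem sliceVol_lt_top {m : ℕ} {A : Set (Euc (m+1))} (hA : IsCompact A) (s : ℝ) :
    sliceVol A s < ∞ := by
  obtain ⟨R, hR⟩ := hA.isBounded.exists_norm_le
  refine lt_of_le_of_lt (measure_mono ?_) (measure_closedBall_lt_top (x := (0 : Fin m → ℝ)) (r := max R 0))
  intro y hy
  rw [mem_closedBall_zero_iff, pi_norm_le_iff_of_nonneg (le_max_right _ _)]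
  intro i
  have h1 := hR _ hy
  have h2 := PiLp.norm_apply_le (WithLp.toLp 2 (Fin.cons s y : Fin (m+1) → ℝ) : Euc (m+1)) i.succ
  simp only [Fin.cons_succ] at h2
  exact (h2.trans h1).trans (le_max_left _ _)

theorem slice_pos {m : ℕ} {A : Set (Euc (m+1))} (hA : Convex ℝ A) 
    (hi : (interior A).Nonempty) :
    volume {s | (∃ x ∈ A, x 0 = s) ∧ sliceVol A s = 0} = 0 := by
  set π : Euc (m+1) →L[ℝ] ℝ := EuclideanSpace.proj 0 with hπ
  have hconv : Convex ℝ (π '' interior A) := hA.interior.linear_image π.toLinearMap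
  have hopen : IsOpen (π '' interior A) := by
    refine π.isOpenMap (fun r => ⟨EuclideanSpace.single 0 r, by simp [hπ]⟩) _ isOpen_interior
  refine measure_mono_null ?_ (hconv.addHaar_frontier volume)
  rintro s ⟨⟨x, hx, rfl⟩, h0⟩
  rw [hopen.frontier_eq]
  refine ⟨?_, ?_⟩
  · have h1 : x ∈ closure (interior A) := by
      rw [hA.closure_interior_eq_closure_of_nonempty_interior hi]; exact subset_closure hx
    exact image_closure_subset_closure_image π.continuous ⟨x, h1, rfl⟩
  · rintro ⟨y, hy, hyx⟩
    have hyx' : y 0 = x 0 := hyx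
    have hc : Continuous fun z : Fin m → ℝ =>
        (WithLp.toLp 2 (Fin.cons (x 0) z : Fin (m+1) → ℝ) : Euc (m+1)) :=
      (PiLp.continuous_toLp 2 _).comp (continuous_const.finCons continuous_id)
    have hO : IsOpen ((fun z : Fin m → ℝ =>
        (WithLp.toLp 2 (Fin.cons (x 0) z : Fin (m+1) → ℝ) : Euc (m+1))) ⁻¹' interior A) :=
      isOpen_interior.preimage hc
    have hpos := hO.measure_pos volume ⟨fun i => y i.succ, by
      have : (WithLp.toLp 2 (Fin.cons (x 0) (fun i : Fin m => y i.succ) : Fin (m+1) → ℝ) : Euc (m+1)) = y := by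
        ext i
        refine Fin.cases ?_ (fun j => ?_) i <;> simp [hyx']
      simpa only [mem_preimage, this] using hy⟩
    have := hpos.trans_le (measure_mono (preimage_mono interior_subset))
    exact this.ne' h0

theorem haus_slice (m : ℕ) : ∃ c : ℝ≥0, 0 < c ∧ ∀ (A : Set (Euc (m+1))) (s : ℝ),
    μH[(m : ℝ)] (A ∩ {x | x 0 = s}) = c * sliceVol A s := by
  have : Measure.IsAddHaarMeasure (μH[(m:ℝ)] : Measure (EuclideanSpace ℝ (Fin m))) := by
    simpa using MeasureTheory.isAddHaarMeasure_hausdorffMeasure (E := EuclideanSpace ℝ (Fin m))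
  refine ⟨Measure.addHaarScalarFactor (μH[(m:ℝ)] : Measure (EuclideanSpace ℝ (Fin m))) volume,
    Measure.addHaarScalarFactor_pos_of_isAddHaarMeasure _ _, fun A s => ?_⟩
  set ι : EuclideanSpace ℝ (Fin m) → Euc (m+1) := fun y =>
    WithLp.toLp 2 (Fin.cons s y : Fin (m+1) → ℝ) with hι
  have iso : Isometry ι := by
    refine Isometry.of_dist_eq fun x y => ?_
    simp [hι, EuclideanSpace.dist_eq, Fin.sum_univ_succ]
  have hr : range ι = {x | x 0 = s} := by
    ext x
    constructor
    · rintro ⟨y, rfl⟩; simp [hι]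
    · intro hx
      refine ⟨WithLp.toLp 2 fun i => x i.succ, ?_⟩
      ext i
      refine Fin.cases ?_ (fun j => ?_) i
      · simpa [hι] using hx.symm
      · simp [hι]
  rw [← hr, ← iso.hausdorffMeasure_preimage (Or.inl (by positivity))]
  have hH := Measure.isAddLeftInvariant_eq_smul
    (μH[(m:ℝ)] : Measure (EuclideanSpace ℝ (Fin m))) volume
  refine (congrArg (fun μ : Measure (EuclideanSpace ℝ (Fin m)) => μ (ι ⁻¹' A)) hH).trans ?_
  rw [Measure.smul_apply, ENNReal.smul_def, smul_eq_mul, sliceVol,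
    ← (PiLp.volume_preserving_toLp (Fin m)).measure_preimage_emb 
      (MeasurableEquiv.toLp 2 (Fin m → ℝ)).measurableEmbedding]
  simp
  rfl

theorem rotate {m : ℕ} {K : Set (Euc (m+1))} (hK : IsConvexBody K) {θ : Euc (m+1)}
    (hθ : ‖θ‖ = 1) : ∃ A : Set (Euc (m+1)), IsConvexBody A ∧
    (∀ s, μH[(m : ℝ)] (K ∩ hyperplane θ s) = μH[(m : ℝ)] (A ∩ {x | x 0 = s})) ∧
    (∀ s, (K ∩ hyperplane θ s).Nonempty ↔ ∃ x ∈ A, x 0 = s) ∧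
    (∀ s, volume (K ∩ {x | ⟪x, θ⟫ ≤ s}) = volume (A ∩ {x | x 0 ≤ s})) := by
  set e : Euc (m+1) := EuclideanSpace.single 0 1
  set R : Euc (m+1) ≃ₗᵢ[ℝ] Euc (m+1) := (ℝ ∙ (e - θ))ᗮ.reflection with hR
  have hRe : R e = θ := Submodule.reflection_sub (by simp [e, hθ])
  have hin : ∀ x, ⟪R x, θ⟫ = x 0 := by
    intro x
    rw [← hRe, R.inner_map_map]; simp [e, EuclideanSpace.inner_single_right]
  refine ⟨R ⁻¹' K, ⟨hK.convex.linear_preimage R.toLinearMap, ?_, ?_⟩, ?_, ?_, ?_⟩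
  · exact R.toHomeomorph.isCompact_preimage.2 hK.isCompact
  · have := R.toHomeomorph.preimage_interior K
    change ⇑R ⁻¹' interior K = interior (⇑R ⁻¹' K) at this
    rw [← this]
    exact hK.interiorNonempty.preimage R.surjective
  · intro s
    rw [← R.toIsometryEquiv.hausdorffMeasure_preimage]
    congr 1
    ext x
    simp [hyperplane, hin]
  · intro s
    constructor
    · rintro ⟨x, hx, hx'⟩
      obtain ⟨y, rfl⟩ := R.surjective x
      exact ⟨y, hx, by rw [← hin]; exact hx'⟩
    · rintro ⟨y, hy, rfl⟩
      exact ⟨R y, hy, hin y⟩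
  · intro s
    rw [← R.measurePreserving.measure_preimage_emb R.toHomeomorph.measurableEmbedding]
    congr 1
    ext x
    simp [hin]

theorem ftc_slice {m : ℕ} {A : Set (Euc (m+1))} (hA : IsConvexBody A)
    (hc : Continuous fun s => (sliceVol A s).toReal) (s : ℝ) :
    Filter.Tendsto (fun k : ℕ => ((k:ℝ) + 1) * ((volume (A ∩ {x | x 0 ≤ s + 1 / ((k:ℝ)+1)})).toReal
      - (volume (A ∩ {x | x 0 ≤ s})).toReal)) Filter.atTop (nhds (sliceVol A s).toReal) := by
  have hm := hA.isCompact.measurableSet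
  have hint : Integrable fun t => (sliceVol A t).toReal := by
    refine integrable_toReal_of_lintegral_ne_top (measurable_sliceVol hm).aemeasurable ?_
    rw [← volume_slice hm]
    exact hA.isCompact.measure_lt_top.ne
  have e : ∀ s, (volume (A ∩ {x | x 0 ≤ s})).toReal = ∫ t in Iic s, (sliceVol A t).toReal := by
    intro s
    rw [volume_slice_le hm, integral_toReal (measurable_sliceVol hm).aemeasurable
      (ae_of_all _ fun t => sliceVol_lt_top hA.isCompact t)]
  have e2 : ∀ t, (volume (A ∩ {x | x 0 ≤ t})).toReal = 
      (∫ u in Iic s, (sliceVol A u).toReal) + ∫ u in s..t, (sliceVol A u).toReal := by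
    intro t
    rw [e, ← intervalIntegral.integral_Iic_sub_Iic hint.integrableOn hint.integrableOn]
    ring
  have hd : HasDerivAt (fun t => (volume (A ∩ {x | x 0 ≤ t})).toReal) (sliceVol A s).toReal s := by
    simp_rw [e2]
    exact (intervalIntegral.integral_hasDerivAt_right (hc.intervalIntegrable _ _)
      (hc.stronglyMeasurableAtFilter _ _) hc.continuousAt).const_add _
  have h1 := hd.tendsto_slope_zero
  have h2 : Filter.Tendsto (fun k : ℕ => 1 / ((k:ℝ) + 1)) Filter.atTop (nhdsWithin 0 {0}ᶜ) := by
    refine tendsto_nhdsWithin_iff.2 ⟨tendsto_one_div_add_atTop_nhds_zero_nat, 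
      Filter.Eventually.of_forall fun k => ?_⟩
    simp only [mem_compl_iff, mem_singleton_iff]
    positivity
  refine (h1.comp h2).congr fun k => ?_
  simp

theorem per_theta {m : ℕ} (hm : 1 ≤ m) {K : Set (Euc (m+1))} (hK : IsConvexBody K) :
    ∃ c : ℝ, ∀ θ : Euc (m+1), ‖θ‖ = 1 → (Continuous (fun s => fTheta K θ s) ∧
      (∃! c : ℝ, ∀ s : ℝ, fTheta K θ s ≤ fTheta K θ c)) →
    Continuous (sectionVolume K θ) ∧
    (∀ N : Set ℝ, volume N = 0 →
      volume {s | sectionVolume K θ s ∈ N ∧ (K ∩ hyperplane θ s).Nonempty} = 0) ∧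
    ∀ s, Filter.Tendsto (fun k : ℕ => c * (((k:ℝ) + 1) *
      ((volume (K ∩ {x | ⟪x, θ⟫ ≤ s + 1 / ((k:ℝ)+1)})).toReal
      - (volume (K ∩ {x | ⟪x, θ⟫ ≤ s})).toReal))) Filter.atTop (nhds (sectionVolume K θ s)) := by
  obtain ⟨c, hc0, hc⟩ := haus_slice m
  refine ⟨c, fun θ hθ => ?_⟩
  rintro ⟨hcont, c₀, hmax, huniq⟩
  obtain ⟨A, hA, hA1, hA2, hA3⟩ := rotate hK hθ
  have hV : ∀ s, sectionVolume K θ s = c * (sliceVol A s).toReal := by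
    intro s
    have : ((m + 1 : ℕ) : ℝ) - 1 = m := by push_cast; ring
    rw [sectionVolume, this, hA1, hc, ENNReal.toReal_mul]
    rfl
  have hc' : (0:ℝ) < c := hc0
  have V0 : ∀ s, 0 ≤ sectionVolume K θ s := fun s => ENNReal.toReal_nonneg
  have hm0 : m ≠ 0 := by omega
  have fe : ∀ s, fTheta K θ s = sectionVolume K θ s ^ ((m:ℝ)⁻¹) := by
    intro s; rw [fTheta]; congr 1; push_cast; rw [one_div]; congr 1; ring
  have hVf : ∀ s, sectionVolume K θ s = fTheta K θ s ^ m := by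
    intro s; rw [fe, Real.rpow_inv_natCast_pow (V0 s) hm0]
  have Vcont : Continuous (sectionVolume K θ) := by
    have : sectionVolume K θ = fun s => fTheta K θ s ^ m := funext hVf
    rw [this]; exact hcont.pow m
  have f0 : ∀ s, 0 ≤ fTheta K θ s := fun s => Real.rpow_nonneg (V0 s) _
  have Vmax : ∀ s ≠ c₀, sectionVolume K θ s < sectionVolume K θ c₀ := by
    intro s hs
    rw [hVf, hVf]
    refine pow_lt_pow_left₀ (lt_of_le_of_ne (hmax s) fun h => hs (huniq s ?_)) (f0 s) hm0
    intro t
    simpa only [h] using hmax t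
  have hAm := hA.isCompact.measurableSet
  have lc : ∀ s t p q : ℝ, 0 < p → 0 < q → p + q = 1 →
      sectionVolume K θ s ^ p * sectionVolume K θ t ^ q ≤ sectionVolume K θ (p * s + q * t) := by
    intro s t p q hp hq hpq
    have h1 := ENNReal.toReal_mono (sliceVol_lt_top hA.isCompact _).ne
      (sliceVol_lc hA.convex hAm s t hp hq hpq)
    rw [ENNReal.toReal_mul, ← ENNReal.toReal_rpow, ← ENNReal.toReal_rpow] at h1
    rw [hV, hV, hV, Real.mul_rpow hc'.le ENNReal.toReal_nonneg,
      Real.mul_rpow hc'.le ENNReal.toReal_nonneg, mul_mul_mul_comm, ← Real.rpow_add hc', hpq,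
      Real.rpow_one]
    gcongr
  refine ⟨Vcont, fun N hN => ?_, fun s => ?_⟩
  · refine measure_mono_null ?_ (measure_union_null (null_pre lc Vmax hN)
      (slice_pos hA.convex hA.interiorNonempty))
    rintro s ⟨h1, h2⟩
    by_cases h3 : sliceVol A s = 0
    · exact Or.inr ⟨(hA2 s).1 h2, h3⟩
    · refine Or.inl ⟨?_, h1⟩
      rw [hV]
      exact mul_pos hc' (ENNReal.toReal_pos h3 (sliceVol_lt_top hA.isCompact s).ne)
  · rw [hV]
    simp only [hA3]
    refine (ftc_slice hA ?_ s).const_mul _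
    have : (fun s => (sliceVol A s).toReal) = fun s => (c:ℝ)⁻¹ * sectionVolume K θ s := by
      ext s; rw [hV]; field_simp
    rw [this]
    exact Vcont.const_mul _

theorem isClosed_hits {n : ℕ} {K : Set (Euc n)} (hK : IsCompact K) :
    IsClosed {z : Euc n × ℝ | (K ∩ hyperplane z.1 z.2).Nonempty} := by
  have : CompactSpace K := isCompact_iff_compactSpace.1 hK
  have h1 : IsClosed {w : (Euc n × ℝ) × K | ⟪(w.2 : Euc n), w.1.1⟫ = w.1.2} :=
    isClosed_eq (by fun_prop) (by fun_prop)
  convert isClosedMap_fst_of_compactSpace _ h1 using 1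
  ext z
  constructor
  · rintro ⟨x, hx, hx'⟩
    exact ⟨(z, ⟨x, hx⟩), hx', rfl⟩
  · rintro ⟨⟨z', x⟩, hx, rfl⟩
    exact ⟨x, x.2, hx⟩

theorem hits_lt_top {n : ℕ} {K : Set (Euc n)} (hK : IsCompact K) (θ : Euc n) :
    volume {s : ℝ | (K ∩ hyperplane θ s).Nonempty} < ∞ := by
  have : {s : ℝ | (K ∩ hyperplane θ s).Nonempty} = (fun x => ⟪x, θ⟫) '' K := by
    ext s
    constructor
    · rintro ⟨x, hx, hx'⟩; exact ⟨x, hx, hx'⟩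
    · rintro ⟨x, hx, hx'⟩; exact ⟨x, hx, hx'⟩
  rw [this]
  exact (hK.image (by fun_prop)).measure_lt_top

theorem hits_ge {n : ℕ} {K : Set (Euc n)} (hK : IsConvexBody K) :
    ∃ r : ℝ, 0 < r ∧ ∀ θ : Euc n, ‖θ‖ = 1 →
      r ≤ (volume {s : ℝ | (K ∩ hyperplane θ s).Nonempty}).toReal := by
  obtain ⟨x₀, hx₀⟩ := hK.interiorNonempty
  obtain ⟨r, hr, hb⟩ := Metric.isOpen_iff.1 isOpen_interior x₀ hx₀
  refine ⟨r, hr, fun θ hθ => ?_⟩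
  have h1 : Ico ⟪x₀, θ⟫ (⟪x₀, θ⟫ + r) ⊆ {s : ℝ | (K ∩ hyperplane θ s).Nonempty} := by
    rintro s ⟨h1, h2⟩
    refine ⟨x₀ + (s - ⟪x₀, θ⟫) • θ, interior_subset (hb ?_), ?_⟩
    · rw [mem_ball_iff_norm, add_sub_cancel_left, norm_smul, hθ, mul_one, Real.norm_eq_abs,
        abs_of_nonneg (by linarith)]
      linarith
    · simp only [hyperplane, mem_ofPred_eq, inner_add_left, inner_smul_left]
      rw [real_inner_self_eq_norm_sq, hθ]; simp
  have h2 := ENNReal.toReal_mono (hits_lt_top hK.isCompact θ).ne (measure_mono (μ := volume) h1)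
  simpa [hr.le] using h2

theorem measurable_halfvol {n : ℕ} {K : Set (Euc n)} (hK : MeasurableSet K) :
    Measurable fun z : Euc n × ℝ => volume (K ∩ {x | ⟪x, z.1⟫ ≤ z.2}) := by
  have : MeasurableSet {w : (Euc n × ℝ) × Euc n | w.2 ∈ K ∧ ⟪w.2, w.1.1⟫ ≤ w.1.2} :=
    (measurable_snd hK).inter (measurableSet_le
      (f := fun w : (Euc n × ℝ) × Euc n => ⟪w.2, w.1.1⟫) (g := fun w => w.1.2)
      (by fun_prop) (by fun_prop))
  exact measurable_measure_prodMk_left this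

/-- if for almost every direction `θ` in the upper hemisphere the function
`f_θ(s) = vol_{n-1}(K ∩ T_{θ,s})^{1/(n-1)}` is continuous on `ℝ` and attains its maximum at a
unique point, then the section volume CDF `G_K` is absolutely continuous. -/
theorem sectionCDF_absolutelyContinuous_of_unique_max {n : ℕ} (hn : 2 ≤ n)
    (K : Set (Euc n)) (hK : IsConvexBody K)
    (h : ∀ᵐ θ ∂((sphMeasure n).restrict (upperHemi n)),
      Continuous (fun s => fTheta K θ s) ∧
      (∃! c : ℝ, ∀ s : ℝ, fTheta K θ s ≤ fTheta K θ c)) :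
    IsAbsolutelyContinuousCDF (sectionCDF K) := by
  obtain ⟨m, rfl⟩ : ∃ m, n = m + 1 := ⟨n - 1, by omega⟩
  have hm : 1 ≤ m := by omega
  obtain ⟨c, hc⟩ := per_theta hm hK
  set ν := (sphMeasure (m+1)).restrict (upperHemi (m+1)) with hν
  have hcl : IsClosed (upperHemi (m+1)) := by
    have : upperHemi (m+1) = {θ | ‖θ‖ = 1} ∩
        ⋂ i : Fin (m+1), {θ | (i : ℕ) = m + 1 - 1 → 0 ≤ θ i} := by
      ext θ; simp [upperHemi]
    rw [this]
    refine (isClosed_eq continuous_norm continuous_const).inter (isClosed_iInter fun i => ?_)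
    by_cases hi : (i : ℕ) = m + 1 - 1
    · simp only [hi, forall_true_left]
      exact isClosed_le continuous_const (by fun_prop)
    · simp only [hi, false_imp_iff]
      exact isClosed_univ
  have hmem : ∀ᵐ θ ∂ν, ‖θ‖ = 1 :=
    (ae_restrict_mem hcl.measurableSet).mono fun θ hθ => hθ.1
  have hgood := (hmem.and h).mono fun θ hθ => hc θ hθ.1 hθ.2
  clear h hc
  set E : Set (Euc (m+1) × ℝ) := {z | (K ∩ hyperplane z.1 z.2).Nonempty} with hE
  have Em : MeasurableSet E := (isClosed_hits hK.isCompact).measurableSet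
  have Eθ : ∀ θ, MeasurableSet {s : ℝ | (K ∩ hyperplane θ s).Nonempty} := fun θ =>
    measurable_prodMk_left (x := θ) Em
  by_cases hmu : muBracket K = 0
  · exact ⟨fun _ => 0, fun _ => le_rfl, fun z => by simp [sectionCDF, hmu]⟩
  have hmu2 : muBracket K = ∫ θ, (volume {s : ℝ | (K ∩ hyperplane θ s).Nonempty}).toReal ∂ν := by
    rw [muBracket]
    refine integral_congr_ae (ae_of_all _ fun θ => ?_)
    exact integral_indicator_one (Eθ θ)
  have hint : Integrable
      (fun θ => (volume {s : ℝ | (K ∩ hyperplane θ s).Nonempty}).toReal) ν := by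
    by_contra hcon
    exact hmu (hmu2.trans (integral_undef hcon))
  have hmu0 : 0 ≤ muBracket K := by
    rw [hmu2]; exact integral_nonneg fun θ => ENNReal.toReal_nonneg
  obtain ⟨r, hr, hr'⟩ := hits_ge hK
  have : IsFiniteMeasure ν := by
    have h1 : Integrable (fun _ : Euc (m+1) => r) ν := by
      refine hint.mono aestronglyMeasurable_const (hmem.mono fun θ hθ => ?_)
      rw [Real.norm_of_nonneg hr.le, Real.norm_of_nonneg ENNReal.toReal_nonneg]
      exact hr' θ hθ
    rw [integrable_const_iff] at h1
    exact h1.resolve_left hr.ne'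
  have Vae : AEMeasurable (fun z : Euc (m+1) × ℝ => sectionVolume K z.1 z.2)
      (ν.prod volume) := by
    refine aemeasurable_of_tendsto_metrizable_ae Filter.atTop
      (f := fun (k : ℕ) (z : Euc (m+1) × ℝ) => c * (((k:ℝ) + 1) *
      ((volume (K ∩ {x | ⟪x, z.1⟫ ≤ z.2 + 1 / ((k:ℝ)+1)})).toReal
      - (volume (K ∩ {x | ⟪x, z.1⟫ ≤ z.2})).toReal))) (fun k => ?_) ?_
    · have m1 := (measurable_halfvol hK.isCompact.measurableSet).ennreal_toReal
      have m2 := m1.comp (g := fun z : Euc (m+1) × ℝ =>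
        (volume (K ∩ {x | ⟪x, z.1⟫ ≤ z.2})).toReal)
        (f := fun z : Euc (m+1) × ℝ => (z.1, z.2 + 1 / ((k:ℝ)+1))) (by fun_prop)
      exact (((m2.sub m1).const_mul _).const_mul _).aemeasurable
    · have := Measure.quasiMeasurePreserving_fst (μ := ν) (ν := (volume : Measure ℝ)) |>.ae hgood
      exact this.mono fun z hz => hz.2.2 z.2
  set V : Euc (m+1) × ℝ → ℝ := fun z => sectionVolume K z.1 z.2 with hV
  set P := (ν.prod volume).restrict E with hP
  have VP : AEMeasurable V P := Vae.restrict
  have nm : ∀ T, MeasurableSet T → NullMeasurableSet (V ⁻¹' T ∩ E) (ν.prod volume) :=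
    fun T hT => (Vae.nullMeasurable hT).inter Em.nullMeasurableSet
  have sec : ∀ T, MeasurableSet T → ∀ᵐ θ ∂ν,
      ∫⁻ s, (V ⁻¹' T ∩ E).indicator 1 (θ, s) =
        volume {s | sectionVolume K θ s ∈ T ∧ (K ∩ hyperplane θ s).Nonempty} := by
    intro T hT
    refine hgood.mono fun θ hθ => ?_
    exact lintegral_indicator_one ((hθ.1.measurable hT).inter (Eθ θ))
  have claim : ∀ T, MeasurableSet T → P.map V T =
      ∫⁻ θ, volume {s | sectionVolume K θ s ∈ T ∧ (K ∩ hyperplane θ s).Nonempty} ∂ν := by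
    intro T hT
    rw [Measure.map_apply_of_aemeasurable VP hT, hP, Measure.restrict_apply' Em,
      ← lintegral_indicator_one₀ (nm T hT), lintegral_prod]
    · exact lintegral_congr_ae (sec T hT)
    · exact aemeasurable_const.indicator₀ (nm T hT)
  have sm : ∀ T, MeasurableSet T → AEMeasurable
      (fun θ => volume {s | sectionVolume K θ s ∈ T ∧ (K ∩ hyperplane θ s).Nonempty}) ν := by
    intro T hT
    refine AEMeasurable.congr ?_ (sec T hT)
    exact (AEMeasurable.lintegral_prod_right' (aemeasurable_const.indicator₀ (nm T hT)))
  have lt : ∀ θ (T : Set ℝ), volume {s | sectionVolume K θ s ∈ T ∧ (K ∩ hyperplane θ s).Nonempty} < ∞ :=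
    fun θ T => (measure_mono fun s hs => hs.2).trans_lt (hits_lt_top hK.isCompact θ)
  have : IsFiniteMeasure (P.map V) := by
    refine ⟨?_⟩
    rw [claim univ .univ]
    have := hint.2
    simp only [hasFiniteIntegral_iff_enorm] at this
    refine lt_of_le_of_lt (lintegral_mono fun θ => ?_) this
    simp only [mem_univ, true_and]
    rw [Real.enorm_eq_ofReal ENNReal.toReal_nonneg,
      ENNReal.ofReal_toReal (hits_lt_top hK.isCompact θ).ne]
  have hac : P.map V ≪ volume := by
    refine Measure.AbsolutelyContinuous.mk fun T hT hT0 => ?_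
    rw [claim T hT, lintegral_congr_ae (hgood.mono fun θ hθ => hθ.2.1 T hT0)]
    simp
  refine ⟨fun t => (1 / muBracket K) * ((P.map V).rnDeriv volume t).toReal, fun t => by positivity,
    fun z => ?_⟩
  rw [integral_const_mul, Measure.setIntegral_toReal_rnDeriv hac, Measure.real,
    claim _ measurableSet_Iic, ← integral_toReal (sm _ measurableSet_Iic)
      (ae_of_all _ fun θ => lt θ _), sectionCDF]
  congr 1
  refine integral_congr_ae (hgood.mono fun θ hθ => ?_)
  exact integral_indicator_one ((hθ.1.measurable measurableSet_Iic).inter (Eθ θ))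
end
end

section
/- Let n ≥ 2 and let K ∈ 𝒦ⁿ be a strictly convex body. Then its section volume CDF G_K is absolutely continuous with respect to Lebesgue measure. -/
open MeasureTheory Set Pointwise
open scoped RealInnerProductSpace NNReal ENNReal

noncomputable section

/-- One-dimensional Brunn-Minkowski inequality. -/
theorem bm_one {A B C : Set ℝ} (hA : MeasurableSet A) (hB : MeasurableSet B)
    (hA0 : A.Nonempty) (hB0 : B.Nonempty)
    (hC : ∀ a ∈ A, ∀ b ∈ B, a + b ∈ C) : volume A + volume B ≤ volume C := by
  have key : ∀ A' B' : Set ℝ, A' ⊆ A → B' ⊆ B → IsCompact A' → IsCompact B' →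
      A'.Nonempty → B'.Nonempty → volume A' + volume B' ≤ volume C := by
    intro A' B' hA' hB' cA cB nA nB
    obtain ⟨α, hα⟩ := cA.exists_isGreatest nA
    obtain ⟨β, hβ⟩ := cB.exists_isLeast nB
    have h1 : volume ((fun x => x + β) '' A') = volume A' := by
      simp
    have h2 : volume ((fun x => α + x) '' B') = volume B' := by
      simp
    rw [← h1, ← h2, ← measure_union₀]
    · apply measure_mono
      rintro _ (⟨x, hx, rfl⟩ | ⟨x, hx, rfl⟩)
      · exact hC _ (hA' hx) _ (hB' hβ.1)
      · exact hC _ (hA' hα.1) _ (hB' hx)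
    · exact (cB.image (by fun_prop)).measurableSet.nullMeasurableSet
    · refine measure_mono_null (t := {α + β}) ?_ (by simp)
      rintro _ ⟨⟨x, hx, rfl⟩, ⟨y, hy, h⟩⟩
      have := hα.2 hx
      have := hβ.2 hy
      simp only [mem_singleton_iff] at *
      linarith
  obtain ⟨a0, ha0⟩ := hA0
  obtain ⟨b0, hb0⟩ := hB0
  rw [hA.measure_eq_iSup_isCompact, hB.measure_eq_iSup_isCompact]
  simp only [iSup_and']
  refine ENNReal.biSup_add_biSup_le' ⟨∅, by simp⟩ ⟨∅, by simp⟩ ?_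
  rintro A' ⟨hA', cA⟩ B' ⟨hB', cB⟩
  refine le_trans (add_le_add (measure_mono (subset_insert a0 A'))
    (measure_mono (subset_insert b0 B'))) (key _ _ ?_ ?_ (cA.insert _) (cB.insert _)
      (insert_nonempty _ _) (insert_nonempty _ _))
  · exact insert_subset ha0 hA'
  · exact insert_subset hb0 hB'

/-- The Prekopa-Leindler property with weights `p`, `q`. -/
def PL (p q : ℝ) {X : Type*} [AddCommGroup X] [Module ℝ X] [MeasurableSpace X] (μ : Measure X) :
    Prop :=
  ∀ f g h : X → ℝ≥0∞, Measurable f → Measurable g → Measurable h →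
    (∀ x y, f x ^ p * g y ^ q ≤ h (p • x + q • y)) →
    (∫⁻ x, f x ∂μ) ^ p * (∫⁻ x, g x ∂μ) ^ q ≤ ∫⁻ x, h x ∂μ

theorem PL.prod {p q : ℝ} {X Y : Type*} [AddCommGroup X] [Module ℝ X] [MeasurableSpace X]
    [AddCommGroup Y] [Module ℝ Y] [MeasurableSpace Y] {μ : Measure X} {ν : Measure Y}
    [SFinite μ] [SFinite ν] (hμ : PL p q μ) (hν : PL p q ν) : PL p q (μ.prod ν) := by
  intro f g h hf hg hh H
  rw [lintegral_prod _ hf.aemeasurable, lintegral_prod _ hg.aemeasurable,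
    lintegral_prod _ hh.aemeasurable]
  refine hμ _ _ _ hf.lintegral_prod_right' hg.lintegral_prod_right' hh.lintegral_prod_right' ?_
  intro x x'
  refine hν _ _ _ (by fun_prop) (by fun_prop) (by fun_prop) ?_
  intro y y'
  exact H (x, y) (x', y')

theorem PL.of_equiv {p q : ℝ} {X Y : Type*} [AddCommGroup X] [Module ℝ X] [MeasurableSpace X]
    [AddCommGroup Y] [Module ℝ Y] [MeasurableSpace Y] {μ : Measure X} {ν : Measure Y}
    (hμ : PL p q μ) (e : X ≃ᵐ Y) (he : MeasurePreserving e μ ν)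
    (hl : ∀ x y, e (p • x + q • y) = p • e x + q • e y) : PL p q ν := by
  intro f g h hf hg hh H
  rw [← he.lintegral_comp hf, ← he.lintegral_comp hg, ← he.lintegral_comp hh]
  refine hμ _ _ _ (hf.comp e.measurable) (hg.comp e.measurable) (hh.comp e.measurable) ?_
  intro x y
  simpa [hl] using H (e x) (e y)

theorem pl_stepA {p q : ℝ} (hp : 0 < p) (hq : 0 < q) (f g h : ℝ → ℝ)
    (hf : Measurable f) (hg : Measurable g) (hh : Measurable h) 
    (f0 : ∀ x, 0 ≤ f x) (g0 : ∀ x, 0 ≤ g x) (h0 : ∀ x, 0 ≤ h x)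
    (f1 : ∀ x, f x ≤ 1) (g1 : ∀ x, g x ≤ 1)
    (fs : ∀ t < 1, ∃ x, t < f x) (gs : ∀ t < 1, ∃ x, t < g x)
    (H : ∀ x y, min (f x) (g y) ≤ h (p * x + q * y)) :
    ENNReal.ofReal p * (∫⁻ x, ENNReal.ofReal (f x)) + ENNReal.ofReal q * (∫⁻ x, ENNReal.ofReal (g x))
      ≤ ∫⁻ x, ENNReal.ofReal (h x) := by
  rw [lintegral_eq_lintegral_meas_lt _ (.of_forall f0) hf.aemeasurable,
    lintegral_eq_lintegral_meas_lt _ (.of_forall g0) hg.aemeasurable,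
    lintegral_eq_lintegral_meas_lt _ (.of_forall h0) hh.aemeasurable,
    ← lintegral_const_mul' _ _ (by simp), ← lintegral_const_mul' _ _ (by simp),
    ← lintegral_add_left]
  · apply lintegral_mono
    intro t
    dsimp only
    rcases lt_or_ge t 1 with ht | ht
    · have e1 : ENNReal.ofReal p * volume {a | t < f a} = volume (p • {a | t < f a}) := by
        rw [Measure.addHaar_smul]; simp [abs_of_pos hp]
      have e2 : ENNReal.ofReal q * volume {a | t < g a} = volume (q • {a | t < g a}) := by
        rw [Measure.addHaar_smul]; simp [abs_of_pos hq]
      rw [e1, e2]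
      refine bm_one ((measurableSet_lt measurable_const hf).const_smul₀ _)
        ((measurableSet_lt measurable_const hg).const_smul₀ _) ?_ ?_ ?_
      · exact Set.Nonempty.smul_set (fs t ht)
      · exact Set.Nonempty.smul_set (gs t ht)
      · rintro _ ⟨x, hx, rfl⟩ _ ⟨y, hy, rfl⟩
        exact lt_of_lt_of_le (lt_min hx hy) (H x y)
    · have : {a | t < f a} = ∅ := by ext x; simpa using (f1 x).trans ht
      have : {a | t < g a} = ∅ := by ext x; simpa using (g1 x).trans ht
      simp [*]
  · apply Measurable.const_mul
    apply Antitone.measurable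
    intro a b hab
    exact measure_mono fun x hx => lt_of_le_of_lt hab hx

theorem amgm {p q : ℝ} (hp : 0 < p) (hq : 0 < q) (hpq : p + q = 1) (a b : ℝ≥0∞) :
    a ^ p * b ^ q ≤ ENNReal.ofReal p * a + ENNReal.ofReal q * b := by
  have hc : (p⁻¹).HolderConjugate q⁻¹ := by
    rw [Real.holderConjugate_iff]
    constructor
    · rw [one_lt_inv₀ hp]; linarith
    · simpa using hpq
  have := ENNReal.young_inequality (a ^ p) (b ^ q) hc
  rw [← ENNReal.rpow_mul, ← ENNReal.rpow_mul, mul_inv_cancel₀ hp.ne', mul_inv_cancel₀ hq.ne'] at this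
  rw [ENNReal.ofReal_inv_of_pos hp, ENNReal.ofReal_inv_of_pos hq] at this
  simpa [div_eq_mul_inv, mul_comm] using this

theorem pl_sup (f : ℝ → ℝ≥0∞) (M : ℝ≥0∞) (M0 : M ≠ 0) (Mt : M ≠ ∞) (hM : M = ⨆ x, f x)
    (ff : ∀ x, f x / M ≤ 1) (t : ℝ) (ht : t < 1) : ∃ x, t < (f x / M).toReal := by
  have : ENNReal.ofReal t * M < M := by
    conv_rhs => rw [← one_mul M]
    exact ENNReal.mul_lt_mul_left M0 Mt (by simpa using ht)
  obtain ⟨x, hx⟩ := lt_iSup_iff.1 (this.trans_eq hM)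
  refine ⟨x, ?_⟩
  have : ENNReal.ofReal t < f x / M := by
    rwa [ENNReal.lt_div_iff_mul_lt (.inl M0) (.inl Mt)]
  refine (le_or_gt 0 t).elim (fun h0 => ?_) fun h0 => h0.trans_le ENNReal.toReal_nonneg
  exact (ENNReal.ofReal_lt_iff_lt_toReal h0 (ne_top_of_le_ne_top (by simp) (ff x))).1 this

theorem pl_bdd {p q : ℝ} (hp : 0 < p) (hq : 0 < q) (hpq : p + q = 1) (f g h : ℝ → ℝ≥0∞)
    (hf : Measurable f) (hg : Measurable g) (hh : Measurable h) (k : ℝ≥0∞) (hk : k ≠ ∞)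
    (f1 : ∀ x, f x ≤ k) (g1 : ∀ x, g x ≤ k)
    (H : ∀ x y, f x ^ p * g y ^ q ≤ h (p * x + q * y)) :
    (∫⁻ x, f x) ^ p * (∫⁻ x, g x) ^ q ≤ ∫⁻ x, h x := by
  set M := ⨆ x, f x with hM
  set N := ⨆ x, g x with hN
  have fM : ∀ x, f x ≤ M := le_iSup f
  have gN : ∀ x, g x ≤ N := le_iSup g
  have Mt : M ≠ ∞ := ne_top_of_le_ne_top hk (iSup_le f1)
  have Nt : N ≠ ∞ := ne_top_of_le_ne_top hk (iSup_le g1)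
  rcases eq_or_ne M 0 with M0 | M0
  · have : ∀ x, f x = 0 := fun x => le_antisymm (M0 ▸ fM x) zero_le
    simp [this, hp]
  rcases eq_or_ne N 0 with N0 | N0
  · have : ∀ x, g x = 0 := fun x => le_antisymm (N0 ▸ gN x) zero_le
    simp [this, hq]
  set c := M ^ p * N ^ q with hc
  have c0 : c ≠ 0 := by
    simp [hc, M0, N0, Mt, Nt]
  have ct : c ≠ ∞ := by
    apply ENNReal.mul_ne_top <;> apply ENNReal.rpow_ne_top_of_nonneg <;> first | positivity | assumption
  have ff : ∀ x, f x / M ≤ 1 := fun x => ENNReal.div_le_of_le_mul (by simpa using fM x)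
  have gg : ∀ x, g x / N ≤ 1 := fun x => ENNReal.div_le_of_le_mul (by simpa using gN x)
  have A := pl_stepA hp hq (fun x => (f x / M).toReal) (fun x => (g x / N).toReal)
    (fun x => (min (h x / c) 1).toReal) (by fun_prop) (by fun_prop) (by fun_prop)
    (fun _ => ENNReal.toReal_nonneg) (fun _ => ENNReal.toReal_nonneg)
    (fun _ => ENNReal.toReal_nonneg) (fun x => ENNReal.toReal_le_of_le_ofReal (by simp) (by simpa using ff x))
    (fun x => ENNReal.toReal_le_of_le_ofReal (by simp) (by simpa using gg x)) ?_ ?_ ?_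
  · have e1 : ∀ x, ENNReal.ofReal (f x / M).toReal = f x / M := fun x =>
      ENNReal.ofReal_toReal (ne_top_of_le_ne_top (by simp) (ff x))
    have e2 : ∀ x, ENNReal.ofReal (g x / N).toReal = g x / N := fun x =>
      ENNReal.ofReal_toReal (ne_top_of_le_ne_top (by simp) (gg x))
    have e3 : ∀ x, ENNReal.ofReal (min (h x / c) 1).toReal ≤ h x / c := fun x =>
      ENNReal.ofReal_toReal_le.trans (min_le_left _ _)
    simp only [e1, e2] at A
    have A2 := A.trans (lintegral_mono e3)
    simp only [div_eq_mul_inv] at A2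
    rw [lintegral_mul_const _ hf, lintegral_mul_const _ hg, lintegral_mul_const _ hh] at A2
    have A3 := (amgm hp hq hpq _ _).trans A2
    rw [ENNReal.mul_rpow_of_nonneg _ _ hp.le, ENNReal.mul_rpow_of_nonneg _ _ hq.le,
      mul_mul_mul_comm, ENNReal.inv_rpow, ENNReal.inv_rpow, ← ENNReal.mul_inv, ← hc] at A3
    · exact (ENNReal.mul_le_mul_iff_left (ENNReal.inv_ne_zero.2 ct) (ENNReal.inv_ne_top.2 c0)).1 A3
    · left; simp [M0, Mt]
    · right; simp [N0, Nt]
  · intro t ht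
    exact pl_sup f M M0 Mt hM ff t ht
  · intro t ht
    exact pl_sup g N N0 Nt hN gg t ht
  · intro x y
    have k0 : f x / M ≠ ∞ := ne_top_of_le_ne_top (by simp) (ff x)
    have k1 : g y / N ≠ ∞ := ne_top_of_le_ne_top (by simp) (gg y)
    rw [← ENNReal.toReal_min k0 k1]
    refine ENNReal.toReal_mono (ne_top_of_le_ne_top (by simp) (min_le_right _ _)) ?_
    refine le_min ?_ ((min_le_left _ _).trans (ff x))
    set m := min (f x / M) (g y / N) with hm
    have : m = m ^ p * m ^ q := by
      rw [← ENNReal.rpow_add_of_nonneg _ _ hp.le hq.le, hpq, ENNReal.rpow_one]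
    rw [this]
    calc m ^ p * m ^ q ≤ (f x / M) ^ p * (g y / N) ^ q := by
          gcongr
          · exact min_le_left _ _
          · exact min_le_right _ _
      _ = (f x ^ p * g y ^ q) / c := by
          simp only [div_eq_mul_inv]
          rw [ENNReal.mul_rpow_of_nonneg _ _ hp.le, ENNReal.mul_rpow_of_nonneg _ _ hq.le,
            mul_mul_mul_comm, ENNReal.inv_rpow, ENNReal.inv_rpow, ← ENNReal.mul_inv, ← hc]
          · left; simp [M0, Mt]
          · right; simp [N0, Nt]
      _ ≤ _ := by gcongr; exact H x y

theorem pl_real {p q : ℝ} (hp : 0 < p) (hq : 0 < q) (hpq : p + q = 1) :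
    PL p q (volume : Measure ℝ) := by
  intro f g h hf hg hh H
  have mono : ∀ f : ℝ → ℝ≥0∞, Measurable f →
      Filter.Tendsto (fun k : ℕ => ∫⁻ x, min (f x) (k : ℝ≥0∞)) Filter.atTop (nhds (∫⁻ x, f x)) := by
    intro f hf
    apply lintegral_tendsto_of_tendsto_of_monotone
    · intro k; fun_prop
    · refine .of_forall fun x a b hab => ?_
      dsimp only
      gcongr
    · refine .of_forall fun x => ?_
      have := (tendsto_const_nhds (x := f x)).min ENNReal.tendsto_nat_nhds_top
      simpa using this
  have hb : ∀ k : ℕ, (∫⁻ x, min (f x) (k : ℝ≥0∞)) ^ p * (∫⁻ x, min (g x) (k : ℝ≥0∞)) ^ q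
      ≤ ∫⁻ x, h x := by
    intro k
    refine pl_bdd hp hq hpq _ _ _ (by fun_prop) (by fun_prop) hh k (by simp)
      (fun x => min_le_right _ _) (fun x => min_le_right _ _) ?_
    intro x y
    refine le_trans ?_ (H x y)
    gcongr
    · exact min_le_left _ _
    · exact min_le_left _ _
  have mono2 : ∀ f : ℝ → ℝ≥0∞, Measurable f →
     (∫⁻ x, f x) = ⨆ k : ℕ, ∫⁻ x, min (f x) (k : ℝ≥0∞) := by
    intro f hf
    refine tendsto_nhds_unique (mono f hf) (tendsto_atTop_iSup ?_)
    intro a b hab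
    apply lintegral_mono
    intro x
    dsimp only
    gcongr
  have sup : ∀ (u : ℕ → ℝ≥0∞) (r : ℝ), 0 < r → (⨆ k, u k) ^ r = ⨆ k, (u k) ^ r := by
    intro u r hr
    exact (ENNReal.orderIsoRpow r hr).map_iSup u
  rw [mono2 f hf, mono2 g hg, sup _ _ hp, sup _ _ hq]
  rw [ENNReal.iSup_mul]
  refine iSup_le fun i => ?_
  rw [ENNReal.mul_iSup]
  refine iSup_le fun j => ?_
  refine le_trans ?_ (hb (max i j))
  gcongr
  · exact le_max_left _ _
  · exact le_max_right _ _

theorem pl_pi {p q : ℝ} (hp : 0 < p) (hq : 0 < q) (hpq : p + q = 1) (d : ℕ) :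
    PL p q (volume : Measure (Fin d → ℝ)) := by
  induction d with
  | zero =>
    intro f g h hf hg hh H
    have := H 0 0
    simp only [volume_pi, Measure.pi_of_empty (x := (0 : Fin 0 → ℝ)), lintegral_dirac]
    simpa using this
  | succ d ih =>
    have e := (volume_preserving_piFinSuccAbove (fun _ : Fin (d + 1) => ℝ) 0).symm
    refine PL.of_equiv ((pl_real hp hq hpq).prod ih) _ e ?_
    intro x y
    ext i
    refine Fin.cases ?_ (fun j => ?_) i <;>
      simp [MeasurableEquiv.piFinSuccAbove]

theorem pl_euc {p q : ℝ} (hp : 0 < p) (hq : 0 < q) (hpq : p + q = 1) (d : ℕ) :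
    PL p q (volume : Measure (EuclideanSpace ℝ (Fin d))) :=
  PL.of_equiv (pl_pi hp hq hpq d) (MeasurableEquiv.toLp 2 (Fin d → ℝ)) 
    (PiLp.volume_preserving_toLp (Fin d)) (fun x y => by simp)

theorem pl_sets {p q : ℝ} (hp : 0 < p) (hq : 0 < q) {X : Type*}
    [AddCommGroup X] [Module ℝ X] [MeasurableSpace X] {μ : Measure X} (h : PL p q μ)
    {A B C : Set X} (hA : MeasurableSet A) (hB : MeasurableSet B) (hC : MeasurableSet C)
    (H : ∀ a ∈ A, ∀ b ∈ B, p • a + q • b ∈ C) : μ A ^ p * μ B ^ q ≤ μ C := by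
  have := h (A.indicator 1) (B.indicator 1) (C.indicator 1) (measurable_one.indicator hA)
    (measurable_one.indicator hB) (measurable_one.indicator hC) ?_
  · simpa [lintegral_indicator_one, hA, hB, hC] using this
  · intro x y
    by_cases hx : x ∈ A
    · by_cases hy : y ∈ B
      · simp [hx, hy, H x hx y hy]
      · simp [hx, hy, hq]
    · simp [hx, hp]

theorem null_of_anti {φ : ℝ → ℝ} {S N : Set ℝ} (hN : volume N = 0) {c : ℝ} (hc : 0 < c)
    (h : ∀ x ∈ S, ∀ y ∈ S, x < y → c * (y - x) ≤ |φ y - φ x|) : volume (S ∩ φ ⁻¹' N) = 0 := by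
  have hd : ∀ x ∈ S, ∀ y ∈ S, c * |x - y| ≤ |φ x - φ y| := by
    intro x hx y hy
    rcases lt_trichotomy x y with hxy | rfl | hxy
    · rw [abs_sub_comm, abs_of_pos (sub_pos.2 hxy), abs_sub_comm]; exact h x hx y hy hxy
    · simp
    · rw [abs_of_pos (sub_pos.2 hxy)]; exact h y hy x hx hxy
  have hinj : InjOn φ S := by
    intro x hx y hy hxy
    have := hd x hx y hy
    rw [hxy, sub_self, abs_zero] at this
    have h3 : |x - y| ≤ 0 := by nlinarith [abs_nonneg (x - y)]
    exact sub_eq_zero.1 (abs_nonpos_iff.1 h3)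
  have hlip : LipschitzOnWith ⟨c⁻¹, by positivity⟩ (Function.invFunOn φ S) (φ '' S) := by
    refine LipschitzOnWith.of_dist_le_mul ?_
    rintro _ ⟨x, hx, rfl⟩ _ ⟨y, hy, rfl⟩
    rw [hinj.leftInvOn_invFunOn hx, hinj.leftInvOn_invFunOn hy, Real.dist_eq, Real.dist_eq]
    have := hd x hx y hy
    change _ ≤ c⁻¹ * _
    rw [inv_mul_eq_div, le_div_iff₀ hc]
    linarith
  have h2 := (hlip.mono (inter_subset_left (t := N))).hausdorffMeasure_image_le (d := 1) zero_le_one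
  rw [hausdorffMeasure_real, measure_mono_null inter_subset_right hN, mul_zero] at h2
  refine measure_mono_null ?_ (le_antisymm h2 zero_le)
  rintro x ⟨hx, hxN⟩
  exact ⟨φ x, ⟨⟨x, hx, rfl⟩, hxN⟩, hinj.leftInvOn_invFunOn hx⟩

theorem null_of_strictConcave {φ : ℝ → ℝ} {J N : Set ℝ} (hJ : IsOpen J)
    (hφ : StrictConcaveOn ℝ J φ) (hN : volume N = 0) : volume (J ∩ φ ⁻¹' N) = 0 := by
  have hcont : ContinuousOn φ J := hφ.concaveOn.continuousOn hJ
  set M := {x ∈ J | IsMaxOn φ J x} with hM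
  have hMs : M.Subsingleton := fun x hx y hy => hφ.eq_of_isMaxOn hx.2 hy.2 hx.1 hy.1
  have h1 : volume ((J \ M) ∩ φ ⁻¹' N) = 0 := by
    refine measure_null_of_locally_null _ ?_
    rintro x ⟨⟨hxJ, hxM⟩, hxN⟩
    have : ∃ y ∈ J, φ x < φ y := by
      by_contra! hcon
      exact hxM ⟨hxJ, hcon⟩
    obtain ⟨y, hyJ, hxy⟩ := this
    have hev : ∀ᶠ z in nhds x, z ∈ J ∧ φ z < φ y :=
      (hJ.eventually_mem hxJ).and
        (((hcont x hxJ).continuousAt (hJ.mem_nhds hxJ)).eventually_lt continuousAt_const hxy)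
    have hne : x ≠ y := by rintro rfl; exact lt_irrefl _ hxy
    rcases lt_or_gt_of_ne hne with hlt | hlt
    · have hev2 := hev.and (eventually_lt_nhds hlt)
      obtain ⟨q, hq, hqx⟩ := ((hev2.filter_mono nhdsWithin_le_nhds).and
        (self_mem_nhdsWithin : Ioi x ∈ nhdsWithin x (Ioi x))).exists
      obtain ⟨⟨hqJ, hqy⟩, hqy'⟩ := hq
      refine ⟨(J ∩ Iio q) ∩ φ ⁻¹' N, ?_, ?_⟩
      · have : Iio q ∈ nhdsWithin x (J \ M ∩ φ ⁻¹' N) := mem_nhdsWithin_of_mem_nhds (Iio_mem_nhds hqx)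
        filter_upwards [this, self_mem_nhdsWithin] with z hz hz2
        exact ⟨⟨hz2.1.1, hz⟩, hz2.2⟩
      · refine null_of_anti hN (c := (φ y - φ q) / (y - q))
          (div_pos (sub_pos.2 hqy) (sub_pos.2 hqy')) ?_
        rintro u ⟨huJ, hu⟩ v ⟨hvJ, hv⟩ huv
        have s1 := hφ.concaveOn.slope_anti_adjacent huJ hqJ huv hv
        have s2 := hφ.concaveOn.slope_anti_adjacent hvJ hyJ hv hqy'
        have := s2.trans s1
        rw [le_div_iff₀ (sub_pos.2 huv)] at this
        exact this.trans (le_abs_self _)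
    · have hev2 := hev.and (eventually_gt_nhds hlt)
      obtain ⟨q, hq, hqx⟩ := ((hev2.filter_mono nhdsWithin_le_nhds).and
        (self_mem_nhdsWithin : Iio x ∈ nhdsWithin x (Iio x))).exists
      obtain ⟨⟨hqJ, hqy⟩, hqy'⟩ := hq
      refine ⟨(J ∩ Ioi q) ∩ φ ⁻¹' N, ?_, ?_⟩
      · have : Ioi q ∈ nhdsWithin x (J \ M ∩ φ ⁻¹' N) := mem_nhdsWithin_of_mem_nhds (Ioi_mem_nhds hqx)
        filter_upwards [this, self_mem_nhdsWithin] with z hz hz2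
        exact ⟨⟨hz2.1.1, hz⟩, hz2.2⟩
      · refine null_of_anti hN (c := (φ y - φ q) / (q - y))
          (div_pos (sub_pos.2 hqy) (sub_pos.2 hqy')) ?_
        rintro u ⟨huJ, hu⟩ v ⟨hvJ, hv⟩ huv
        have s1 := hφ.concaveOn.slope_anti_adjacent hqJ hvJ hu huv
        have s2 := hφ.concaveOn.slope_anti_adjacent hyJ huJ hqy' hu
        have := s1.trans s2
        rw [div_le_iff₀ (sub_pos.2 huv)] at this
        rw [abs_sub_comm]
        refine le_trans ?_ (le_abs_self _)
        have e : (φ y - φ q) / (q - y) = - ((φ q - φ y) / (q - y)) := by ring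
        rw [e]; linarith
  refine measure_mono_null (t := ((J \ M) ∩ φ ⁻¹' N) ∪ M) ?_
    (measure_union_null h1 (hMs.measure_zero _))
  rintro x ⟨hx, hxN⟩
  by_cases h : x ∈ M
  · exact .inr h
  · exact .inl ⟨⟨hx, h⟩, hxN⟩

theorem null_of_strictConcave_log {W : ℝ → ℝ} {J N : Set ℝ} (hJ : IsOpen J)
    (hW : ∀ s ∈ J, 0 < W s)
    (hφ : StrictConcaveOn ℝ J (fun s => Real.log (W s))) (hN : volume N = 0) :
    volume (J ∩ W ⁻¹' N) = 0 := by
  have h1 : volume (Real.log '' (N ∩ Ioi 0)) = 0 := by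
    refine addHaar_image_eq_zero_of_differentiableOn_of_addHaar_eq_zero _ ?_
      (measure_mono_null inter_subset_left hN)
    intro x hx
    exact (Real.differentiableAt_log (ne_of_gt hx.2)).differentiableWithinAt
  refine measure_mono_null ?_ (null_of_strictConcave hJ hφ h1)
  rintro x ⟨hx, hxN⟩
  exact ⟨hx, W x, ⟨hxN, hW x hx⟩, rfl⟩

theorem measure_lt_of_compact_open {E : Type*} [NormedAddCommGroup E] [NormedSpace ℝ E]
    [Nontrivial E] [MeasurableSpace E] [BorelSpace E] {m : Measure E}
    [m.IsOpenPosMeasure] [IsFiniteMeasureOnCompacts m] {C U : Set E} (hC : IsCompact C) (hU : IsOpen U)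
    (hU0 : U.Nonempty) (hCU : C ⊆ U) : m C < m U := by
  have hne : (U \ C).Nonempty := by
    by_contra hcon
    rw [not_nonempty_iff_eq_empty, sdiff_eq_empty] at hcon
    have : U = C := hcon.antisymm hCU
    subst this
    have hcl : IsClopen U := ⟨hC.isClosed, hU⟩
    rcases isClopen_iff.1 hcl with h | h
    · exact hU0.ne_empty h
    · exact hC.ne_univ h
  have hpos : 0 < m (U \ C) := (hU.sdiff hC.isClosed).measure_pos m hne
  rw [← measure_sdiff_add_inter U hC.measurableSet, inter_eq_self_of_subset_right hCU, add_comm]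
  exact ENNReal.lt_add_right hC.measure_lt_top.ne hpos.ne'


instance haarInst (d : ℕ) :
    (μH[(d : ℝ)] : Measure (EuclideanSpace ℝ (Fin d))).IsAddHaarMeasure := by
  have h := isAddHaarMeasure_hausdorffMeasure (E := EuclideanSpace ℝ (Fin d))
  rwa [finrank_euclideanSpace_fin] at h

theorem exists_frame (d : ℕ) (e : EuclideanSpace ℝ (Fin (d + 1))) (he : ‖e‖ = 1) :
    ∃ j : EuclideanSpace ℝ (Fin d) →ₗᵢ[ℝ] EuclideanSpace ℝ (Fin (d + 1)),
      ∀ x, ⟪x, e⟫ = 0 ↔ x ∈ range j := by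
  have he0 : e ≠ 0 := by rintro rfl; simp at he
  have : Fact (Module.finrank ℝ (EuclideanSpace ℝ (Fin (d + 1))) = d + 1) := ⟨by simp⟩
  have hf : Module.finrank ℝ (ℝ ∙ e)ᗮ = d := Submodule.finrank_orthogonal_span_singleton he0
  let b := (stdOrthonormalBasis ℝ (ℝ ∙ e)ᗮ).reindex (finCongr hf)
  refine ⟨(ℝ ∙ e)ᗮ.subtypeₗᵢ.comp b.repr.symm.toLinearIsometry, fun x => ?_⟩
  rw [real_inner_comm, ← Submodule.mem_orthogonal_singleton_iff_inner_right]
  constructor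
  · intro hx
    exact ⟨b.repr ⟨x, hx⟩, by simp⟩
  · rintro ⟨y, rfl⟩
    simp

theorem normalize_lip {V : Type*} [NormedAddCommGroup V] [NormedSpace ℝ V] :
    LipschitzOnWith 2 (fun x : V => ‖x‖⁻¹ • x) {x | 1 ≤ ‖x‖} := by
  refine LipschitzOnWith.of_dist_le_mul ?_
  intro x hx y hy
  have hx0 : 0 < ‖x‖ := lt_of_lt_of_le one_pos hx
  have hy0 : 0 < ‖y‖ := lt_of_lt_of_le one_pos hy
  rw [dist_eq_norm, dist_eq_norm]
  have : ‖x‖⁻¹ • x - ‖y‖⁻¹ • y = ‖x‖⁻¹ • (x - y) + (‖x‖⁻¹ - ‖y‖⁻¹) • y := by module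
  rw [this]
  refine (norm_add_le _ _).trans ?_
  rw [norm_smul, norm_smul]
  have h1 : ‖x‖⁻¹ ≤ 1 := inv_le_one_of_one_le₀ hx
  have e1 : ‖‖x‖⁻¹‖ = ‖x‖⁻¹ := by simp
  have e2 : ‖‖x‖⁻¹ - ‖y‖⁻¹‖ * ‖y‖ = ‖x‖⁻¹ * |‖y‖ - ‖x‖| := by
    rw [inv_sub_inv hx0.ne' hy0.ne', Real.norm_eq_abs, abs_div, abs_of_pos (mul_pos hx0 hy0)]
    field_simp
  rw [e1, e2]
  have h3 : |‖y‖ - ‖x‖| ≤ ‖x - y‖ := by rw [norm_sub_rev]; exact abs_norm_sub_norm_le y x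
  have h4 := norm_nonneg (x - y)
  have h5 := inv_nonneg.2 hx0.le
  have : ‖x‖⁻¹ * |‖y‖ - ‖x‖| ≤ 1 * ‖x - y‖ := by gcongr
  have : ‖x‖⁻¹ * ‖x - y‖ ≤ 1 * ‖x - y‖ := by gcongr
  push_cast
  linarith

theorem sphere_finite (d : ℕ) :
    (μH[(d : ℝ)] : Measure (EuclideanSpace ℝ (Fin (d + 1)))) {θ | ‖θ‖ = 1} < ∞ := by
  have hS : {θ : EuclideanSpace ℝ (Fin (d + 1)) | ‖θ‖ = 1} = Metric.sphere 0 1 := by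
    ext; simp
  rw [hS]
  refine (isCompact_sphere _ _).measure_lt_top_of_nhdsWithin ?_
  intro e he
  replace he : ‖e‖ = 1 := by simpa using he
  obtain ⟨j, hj⟩ := exists_frame d e he
  have hperp : ∀ y, ⟪j y, e⟫ = 0 := fun y => (hj _).2 ⟨y, rfl⟩
  let Φ : EuclideanSpace ℝ (Fin d) → EuclideanSpace ℝ (Fin (d + 1)) := fun y => j y + e
  have hΦ1 : ∀ y, 1 ≤ ‖Φ y‖ := by
    intro y
    have : ⟪Φ y, e⟫ = 1 := by
      simp [Φ, inner_add_left, hperp, he]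
    have h2 := real_inner_le_norm (Φ y) e
    rw [this, he] at h2
    linarith
  have hΦ : LipschitzWith 1 Φ := by
    refine LipschitzWith.of_dist_le_mul fun x y => ?_
    simp [Φ, dist_eq_norm, ← map_sub]
  have hΨ := normalize_lip.comp (hΦ.lipschitzOnWith (s := Metric.closedBall 0 3)) (fun y _ => hΦ1 y)
  refine ⟨((fun x => ‖x‖⁻¹ • x) ∘ Φ) '' Metric.closedBall 0 3, ?_, ?_⟩
  · have : {θ | 1 / 2 < ⟪θ, e⟫} ∈ nhdsWithin e (Metric.sphere 0 1) := by
      refine mem_nhdsWithin_of_mem_nhds (IsOpen.mem_nhds ?_ ?_)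
      · exact isOpen_lt continuous_const (by fun_prop)
      · simp [he]; norm_num
    filter_upwards [this, self_mem_nhdsWithin] with θ h1 h2
    replace h2 : ‖θ‖ = 1 := by simpa using h2
    change 1 / 2 < ⟪θ, e⟫ at h1
    set t := ⟪θ, e⟫ with ht
    have ht0 : 0 < t := by linarith
    have : ⟪t⁻¹ • θ - e, e⟫ = 0 := by
      rw [inner_sub_left, inner_smul_left, ← ht, real_inner_self_eq_norm_sq, he]
      simp [ht0.ne']
    obtain ⟨y, hy⟩ := (hj _).1 this
    have hΦy : Φ y = t⁻¹ • θ := by simp [Φ, hy]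
    refine ⟨y, ?_, ?_⟩
    · rw [mem_closedBall_zero_iff, ← j.norm_map, hy]
      refine (norm_sub_le _ _).trans ?_
      rw [norm_smul, h2, he, norm_inv, Real.norm_eq_abs, abs_of_pos ht0]
      have : t⁻¹ ≤ 2 := by
        rw [inv_le_comm₀ ht0 (by norm_num)]; linarith
      linarith
    · simp only [Function.comp, hΦy]
      rw [norm_smul, h2, norm_inv, Real.norm_eq_abs, abs_of_pos ht0, smul_smul]
      simp [ht0.ne']
  · refine (hΨ.hausdorffMeasure_image_le (d := (d : ℝ)) (by positivity)).trans_lt ?_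
    refine ENNReal.mul_lt_top ?_ (isCompact_closedBall _ _).measure_lt_top
    exact ENNReal.rpow_lt_top_of_nonneg (by positivity) (by simp)

theorem PL.smul_measure {p q : ℝ} (hp : 0 < p) (hq : 0 < q) (hpq : p + q = 1) {X : Type*}
    [AddCommGroup X] [Module ℝ X] [MeasurableSpace X] {μ : Measure X} (h : PL p q μ)
    (c : ℝ≥0) : PL p q (c • μ) := by
  intro f g k hf hg hk H
  rw [lintegral_smul_measure, lintegral_smul_measure, lintegral_smul_measure]
  have e : (c : ℝ≥0∞) ^ p * (c : ℝ≥0∞) ^ q = c := by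
    rw [← ENNReal.rpow_add_of_nonneg _ _ hp.le hq.le, hpq, ENNReal.rpow_one]
  simp only [ENNReal.smul_def, smul_eq_mul]
  rw [ENNReal.mul_rpow_of_nonneg _ _ hp.le, ENNReal.mul_rpow_of_nonneg _ _ hq.le,
      mul_mul_mul_comm, e]
  gcongr
  exact h f g k hf hg hk H

theorem pl_haus {p q : ℝ} (hp : 0 < p) (hq : 0 < q) (hpq : p + q = 1) (d : ℕ) :
    PL p q (μH[(d : ℝ)] : Measure (EuclideanSpace ℝ (Fin d))) := by
  rw [Measure.isAddLeftInvariant_eq_smul (μH[(d : ℝ)] : Measure (EuclideanSpace ℝ (Fin d))) volume]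
  exact (pl_euc hp hq hpq d).smul_measure hp hq hpq _

section fixed

variable {d : ℕ} {K : Set (Euc (d + 1))} {θ : Euc (d + 1)} {j : Euc d →ₗᵢ[ℝ] Euc (d + 1)}

theorem inner_frame (hθ : ‖θ‖ = 1) (hj : ∀ x, ⟪x, θ⟫ = 0 ↔ x ∈ range j) (y : Euc d) (s : ℝ) :
    ⟪j y + s • θ, θ⟫ = s := by
  rw [inner_add_left, (hj _).2 ⟨y, rfl⟩, inner_smul_left, real_inner_self_eq_norm_sq, hθ]
  simp

theorem exists_frame_pt (hθ : ‖θ‖ = 1) (hj : ∀ x, ⟪x, θ⟫ = 0 ↔ x ∈ range j) (x : Euc (d + 1)) :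
    ∃ y, j y + ⟪x, θ⟫ • θ = x := by
  have : ⟪x - ⟪x, θ⟫ • θ, θ⟫ = 0 := by
    rw [inner_sub_left, inner_smul_left, real_inner_self_eq_norm_sq, hθ]
    simp
  obtain ⟨y, hy⟩ := (hj _).1 this
  exact ⟨y, by rw [hy]; simp⟩

theorem slice_eq (hθ : ‖θ‖ = 1) (hj : ∀ x, ⟪x, θ⟫ = 0 ↔ x ∈ range j) (s : ℝ) :
    (μH[(d : ℝ)] : Measure (Euc (d + 1))) (K ∩ hyperplane θ s)
      = (μH[(d : ℝ)] : Measure (Euc d)) {y | j y + s • θ ∈ K} := by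
  have hi : Isometry (fun y => j y + s • θ) := by
    refine Isometry.of_dist_eq fun x y => ?_
    simp [dist_eq_norm, ← map_sub]
  rw [← hi.hausdorffMeasure_image (.inl (by positivity))]
  congr 1
  ext x
  constructor
  · rintro ⟨hx, hxs⟩
    obtain ⟨y, hy⟩ := exists_frame_pt hθ hj x
    have hxs' : ⟪x, θ⟫ = s := hxs
    rw [hxs'] at hy
    refine ⟨y, ?_, hy⟩
    change j y + s • θ ∈ K
    rwa [hy]
  · rintro ⟨y, hy, rfl⟩
    exact ⟨hy, inner_frame hθ hj y s⟩

theorem slice_compact (hK : IsCompact K) (s : ℝ) : IsCompact {y : Euc d | j y + s • θ ∈ K} := by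
  have hi : Isometry (fun y => j y + s • θ) := by
    refine Isometry.of_dist_eq fun x y => ?_
    simp [dist_eq_norm, ← map_sub]
  exact hi.isClosedEmbedding.isCompact_preimage hK

theorem slice_strictConcave (hd : 1 ≤ d) (hK : IsStrictlyConvexBody K)
    (hθ : ‖θ‖ = 1) (hj : ∀ x, ⟪x, θ⟫ = 0 ↔ x ∈ range j) :
    StrictConcaveOn ℝ ((fun x => ⟪x, θ⟫) '' interior K) (fun s =>
      Real.log ((μH[(d : ℝ)] : Measure (Euc d)) {y | j y + s • θ ∈ K}).toReal) ∧
    ∀ s ∈ (fun x => ⟪x, θ⟫) '' interior K,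
      0 < ((μH[(d : ℝ)] : Measure (Euc d)) {y | j y + s • θ ∈ K}).toReal := by
  obtain ⟨hcb, hsc⟩ := hK
  have : Nonempty (Fin d) := ⟨⟨0, hd⟩⟩
  have hUo : ∀ s : ℝ, IsOpen {y | j y + s • θ ∈ interior K} := fun s =>
    isOpen_interior.preimage (f := fun y => j y + s • θ) (j.continuous.add continuous_const)
  have hUn : ∀ s ∈ (fun x => ⟪x, θ⟫) '' interior K, {y | j y + s • θ ∈ interior K}.Nonempty := by
    rintro _ ⟨x, hx, rfl⟩
    obtain ⟨y, hy⟩ := exists_frame_pt hθ hj x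
    exact ⟨y, show _ ∈ interior K by rw [hy]; exact hx⟩
  have hfin : ∀ s : ℝ, (μH[(d : ℝ)] : Measure (Euc d)) {y | j y + s • θ ∈ K} ≠ ∞ := fun s =>
    (slice_compact hcb.isCompact s).measure_lt_top.ne
  have hle : ∀ s : ℝ, (μH[(d : ℝ)] : Measure (Euc d)) {y | j y + s • θ ∈ interior K} ≤
      (μH[(d : ℝ)] : Measure (Euc d)) {y | j y + s • θ ∈ K} := fun s =>
    measure_mono fun y hy => interior_subset (s := K) hy
  have hpos : ∀ s ∈ (fun x => ⟪x, θ⟫) '' interior K,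
      0 < ((μH[(d : ℝ)] : Measure (Euc d)) {y | j y + s • θ ∈ K}).toReal := by
    intro s hs
    exact ENNReal.toReal_pos (((hUo s).measure_pos _ (hUn s hs)).trans_le (hle s)).ne' (hfin s)
  have hconv : Convex ℝ ((fun x => ⟪x, θ⟫) '' interior K) :=
    hcb.convex.interior.is_linear_image
      ⟨fun x y => inner_add_left x y θ, fun c x => by simp [inner_smul_left]⟩
  refine ⟨⟨hconv, ?_⟩, hpos⟩
  intro s hs t ht hst p q hp hq hpq
  have hu : p • s + q • t ∈ (fun x => ⟪x, θ⟫) '' interior K := hconv hs ht hp.le hq.le hpq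
  set m : Measure (Euc d) := μH[(d : ℝ)] with hm
  let A := {y : Euc d | j y + s • θ ∈ K}
  let B := {y : Euc d | j y + t • θ ∈ K}
  have cA : IsCompact A := slice_compact hcb.isCompact s
  have cB : IsCompact B := slice_compact hcb.isCompact t
  have cC : IsCompact (p • A + q • B) := (cA.smul p).add (cB.smul q)
  have hsub : p • A + q • B ⊆ {y | j y + (p • s + q • t) • θ ∈ interior K} := by
    rintro _ ⟨_, ⟨a, ha, rfl⟩, _, ⟨b, hb, rfl⟩, rfl⟩
    have hne : j a + s • θ ≠ j b + t • θ := by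
      intro h
      have := congrArg (fun x => ⟪x, θ⟫) h
      simp only [inner_frame hθ hj] at this
      exact hst this
    have := hsc _ ha _ hb hne p ⟨hp, by linarith⟩
    have hq' : 1 - p = q := by linarith
    rw [hq'] at this
    change j (p • a + q • b) + (p • s + q • t) • θ ∈ interior K
    convert this using 1
    simp only [map_add, map_smul, smul_eq_mul]
    module
  have h1 : m A ^ p * m B ^ q ≤ m (p • A + q • B) :=
    pl_sets hp hq (pl_haus hp hq hpq d) cA.measurableSet cB.measurableSet cC.measurableSet
      (fun a ha b hb => add_mem_add (smul_mem_smul_set ha) (smul_mem_smul_set hb))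
  have h2 : m (p • A + q • B) < m {y | j y + (p • s + q • t) • θ ∈ interior K} :=
    measure_lt_of_compact_open cC (hUo _) (hUn _ hu) hsub
  have h3 := (h1.trans_lt h2).trans_le (hle _)
  have h4 := ENNReal.toReal_strict_mono (hfin _) h3
  rw [ENNReal.toReal_mul, ← ENNReal.toReal_rpow, ← ENNReal.toReal_rpow] at h4
  have pA : 0 < (m A).toReal := hpos s hs
  have pB : 0 < (m B).toReal := hpos t ht
  have h5 := Real.log_lt_log (by positivity) h4
  rw [Real.log_mul (by positivity) (by positivity), Real.log_rpow pA, Real.log_rpow pB] at h5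
  exact h5

theorem slice_null (hd : 1 ≤ d) (hK : IsStrictlyConvexBody K)
    (hθ : ‖θ‖ = 1) (hj : ∀ x, ⟪x, θ⟫ = 0 ↔ x ∈ range j) {N : Set ℝ} (hN : volume N = 0) :
    volume {s : ℝ | ((μH[(d : ℝ)] : Measure (Euc d)) {y | j y + s • θ ∈ K}).toReal ∈ N ∧
      (K ∩ hyperplane θ s).Nonempty} = 0 := by
  obtain ⟨h1, h2⟩ := slice_strictConcave hd hK hθ hj
  have hθ0 : θ ≠ 0 := by rintro rfl; simp at hθ
  set J := (fun x => ⟪x, θ⟫) '' interior K with hJ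
  have hJo : IsOpen J := by
    have h : IsOpenMap (innerSL ℝ θ : Euc (d + 1) →L[ℝ] ℝ) := by
      apply ContinuousLinearMap.isOpenMap
      intro c
      refine ⟨c • θ, ?_⟩
      simp [hθ]
    have := h _ (isOpen_interior (s := K))
    convert this using 1
    rw [hJ]
    apply image_congr
    intro x _
    simp [real_inner_comm]
  have h3 := null_of_strictConcave_log hJo h2 h1 hN
  refine measure_mono_null ?_ (measure_union_null h3 (h1.1.addHaar_frontier volume))
  rintro s ⟨hsN, x, hxK, hxs⟩
  have hxs' : ⟪x, θ⟫ = s := hxs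
  by_cases hs : s ∈ J
  · exact .inl ⟨hs, hsN⟩
  · right
    refine ⟨?_, by rwa [hJo.interior_eq]⟩
    have hx : x ∈ closure (interior K) := by
      rw [hK.1.convex.closure_interior_eq_closure_of_nonempty_interior hK.1.interiorNonempty]
      exact subset_closure hxK
    rw [← hxs']
    exact image_closure_subset_closure_image (f := fun x => ⟪x, θ⟫) (by fun_prop) ⟨x, hx, rfl⟩

end fixed

/-- Householder reflection exchanging `e` and `θ`. -/
def house {d : ℕ} (e θ x : Euc d) : Euc d :=
  -((2 : ℝ) • (⟪e - θ, x⟫ / ‖e - θ‖ ^ 2) • (e - θ) - x)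

theorem house_eq {d : ℕ} (e θ x : Euc d) :
    house e θ x = (ℝ ∙ (e - θ))ᗮ.reflection x := by
  rw [Submodule.reflection_orthogonal_apply, Submodule.reflection_singleton_apply]
  simp [house, ofNat_smul_eq_nsmul]

theorem house_frame {d : ℕ} {e θ : Euc (d + 1)} (he : ‖e‖ = 1) (hθ : ‖θ‖ = 1)
    {j : Euc d →ₗᵢ[ℝ] Euc (d + 1)} (hj : ∀ x, ⟪x, e⟫ = 0 ↔ x ∈ range j) :
    ∃ j' : Euc d →ₗᵢ[ℝ] Euc (d + 1), (∀ x, ⟪x, θ⟫ = 0 ↔ x ∈ range j') ∧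
      ∀ y, j' y = house e θ (j y) := by
  set R := (ℝ ∙ (e - θ))ᗮ.reflection with hR
  have hRe : R e = θ := Submodule.reflection_sub (he.trans hθ.symm)
  refine ⟨R.toLinearIsometry.comp j, ?_, fun y => by rw [house_eq]; rfl⟩
  intro x
  have : ⟪x, θ⟫ = ⟪R.symm x, e⟫ := by
    rw [← hRe, ← R.inner_map_map (R.symm x) e]; simp
  rw [this, hj]
  constructor
  · rintro ⟨y, hy⟩
    exact ⟨y, by simp [hy]⟩
  · rintro ⟨y, hy⟩
    exact ⟨y, by simp [← hy]⟩

theorem main_aux {d : ℕ} (hd : 1 ≤ d) (K : Set (Euc (d + 1))) (hK : IsStrictlyConvexBody K) :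
    IsAbsolutelyContinuousCDF (sectionCDF K) := by
  have hdd : (((d + 1 : ℕ) : ℝ) - 1) = d := by push_cast; ring
  let e : Euc (d + 1) := EuclideanSpace.single 0 1
  have he : ‖e‖ = 1 := by simp [e]
  obtain ⟨j, hj⟩ := exists_frame d e he
  set m : Measure (Euc d) := μH[(d : ℝ)] with hm
  -- joint measurability
  let W : Euc (d + 1) × ℝ → ℝ := fun z => (m {y | house e z.1 (j y) + z.2 • z.1 ∈ K}).toReal
  have hKm : MeasurableSet K := hK.1.isCompact.measurableSet
  have hWm : Measurable W := by
    have hF : Measurable (fun w : (Euc (d + 1) × ℝ) × Euc d =>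
        house e w.1.1 (j w.2) + w.1.2 • w.1.1) := by
      have hjm : Measurable j := j.continuous.measurable
      unfold house
      fun_prop
    exact (measurable_measure_prodMk_left (ν := m) (hF hKm)).ennreal_toReal
  let A : Set (Euc (d + 1) × ℝ) := {z | (K ∩ hyperplane z.1 z.2).Nonempty}
  have hAm : MeasurableSet A := by
    have hcl : IsClosed A := by
      have h1 : IsClosed {w : (Euc (d + 1) × ℝ) × K | ⟪(w.2 : Euc (d + 1)), w.1.1⟫ = w.1.2} :=
        isClosed_eq (by fun_prop) (by fun_prop)
      have : CompactSpace K := isCompact_iff_compactSpace.1 hK.1.isCompact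
      have h2 := isClosedMap_fst_of_compactSpace (X := Euc (d + 1) × ℝ) (Y := K) _ h1
      convert h2 using 1
      ext z
      constructor
      · rintro ⟨x, hx, hxz⟩
        exact ⟨(z, ⟨x, hx⟩), hxz, rfl⟩
      · rintro ⟨⟨z', x⟩, hxz, rfl⟩
        exact ⟨x, x.2, hxz⟩
    exact hcl.measurableSet
  have hVW : ∀ θ s, ‖θ‖ = 1 → sectionVolume K θ s = W (θ, s) := by
    intro θ s hθ
    obtain ⟨j', hj', hjj⟩ := house_frame he hθ hj
    simp only [sectionVolume, hdd, W, ← hjj]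
    rw [slice_eq hθ hj']
  -- the measure on the sphere
  have hHm : MeasurableSet (upperHemi (d + 1)) := by
    have : IsClosed (upperHemi (d + 1)) := by
      have : upperHemi (d + 1) = {θ | ‖θ‖ = 1} ∩
          ⋂ i : Fin (d + 1), ⋂ _ : (i : ℕ) = d + 1 - 1, {θ : Euc (d + 1) | 0 ≤ θ i} := by
        ext θ; simp [upperHemi]
      rw [this]
      refine (isClosed_eq continuous_norm continuous_const).inter ?_
      refine isClosed_iInter fun i => isClosed_iInter fun _ => ?_
      exact isClosed_le continuous_const (by fun_prop)
    exact this.measurableSet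
  set σ : Measure (Euc (d + 1)) := (sphMeasure (d + 1)).restrict (upperHemi (d + 1)) with hσ
  have hσu : ∀ᵐ θ ∂σ, ‖θ‖ = 1 := by
    filter_upwards [ae_restrict_mem hHm] with θ hθ using hθ.1
  have hfin : IsFiniteMeasure σ := by
    refine ⟨?_⟩
    rw [hσ, Measure.restrict_apply_univ, sphMeasure, hdd]
    exact (measure_mono fun θ hθ => hθ.1).trans_lt (sphere_finite d)
  obtain ⟨R, hR⟩ := hK.1.isCompact.isBounded.exists_norm_le
  have hsec : ∀ θ : Euc (d + 1), ‖θ‖ = 1 → {s | (θ, s) ∈ A} ⊆ Icc (-R) R := by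
    rintro θ hθ s ⟨x, hx, hxs⟩
    have hxs' : ⟪x, θ⟫ = s := hxs
    have := abs_real_inner_le_norm x θ
    rw [hxs', hθ, mul_one] at this
    exact abs_le.1 (this.trans (hR x hx))
  set M := (σ.prod volume).restrict A with hM
  have hMfin : IsFiniteMeasure M := by
    refine ⟨?_⟩
    rw [hM, Measure.restrict_apply_univ, Measure.prod_apply hAm]
    calc ∫⁻ θ, volume (Prod.mk θ ⁻¹' A) ∂σ ≤ ∫⁻ θ, volume (Icc (-R) R) ∂σ := by
          apply lintegral_mono_ae
          filter_upwards [hσu] with θ hθ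
          exact measure_mono (hsec θ hθ)
      _ < ∞ := by
          rw [lintegral_const]
          exact ENNReal.mul_lt_top (by simp) (measure_lt_top _ _)
  set ν := M.map W with hν
  have hνfin : IsFiniteMeasure ν := by rw [hν]; infer_instance
  have hac : ν ≪ volume := by
    refine Measure.AbsolutelyContinuous.mk fun N hNm hN => ?_
    rw [hν, Measure.map_apply hWm hNm, hM, Measure.restrict_apply (hWm hNm),
      Measure.measure_prod_null ((hWm hNm).inter hAm)]
    filter_upwards [hσu] with θ hθ
    obtain ⟨j', hj', hjj⟩ := house_frame he hθ hj
    have := slice_null hd hK hθ hj' hN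
    simp only [hjj] at this
    exact this
  have hc : 0 ≤ 1 / muBracket K := by
    apply one_div_nonneg.2
    apply integral_nonneg
    intro θ
    apply integral_nonneg
    intro s
    exact indicator_nonneg (fun _ _ => zero_le_one) _
  refine ⟨fun t => 1 / muBracket K * (ν.rnDeriv volume t).toReal,
    fun t => mul_nonneg hc ENNReal.toReal_nonneg, fun z => ?_⟩
  rw [integral_const_mul, Measure.setIntegral_toReal_rnDeriv hac, sectionCDF]
  congr 1
  rw [← hσ]
  have hBm : MeasurableSet (W ⁻¹' Iic z ∩ A) := (hWm measurableSet_Iic).inter hAm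
  have h1 : ν.real (Iic z) = (∫⁻ θ, volume (Prod.mk θ ⁻¹' (W ⁻¹' Iic z ∩ A)) ∂σ).toReal := by
    rw [measureReal_def, hν, Measure.map_apply hWm measurableSet_Iic, hM,
      Measure.restrict_apply (hWm measurableSet_Iic), Measure.prod_apply hBm]
  rw [h1, ← integral_toReal (measurable_measure_prodMk_left hBm).aemeasurable]
  · apply integral_congr_ae
    filter_upwards [hσu] with θ hθ
    have : {s : ℝ | sectionVolume K θ s ≤ z ∧ (K ∩ hyperplane θ s).Nonempty} =
        Prod.mk θ ⁻¹' (W ⁻¹' Iic z ∩ A) := by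
      ext s
      change sectionVolume K θ s ≤ z ∧ _ ↔ W (θ, s) ≤ z ∧ (K ∩ hyperplane θ s).Nonempty
      rw [hVW θ s hθ]
    rw [this, integral_indicator_const _ (measurable_prodMk_left hBm)]
    simp [measureReal_def]
  · filter_upwards [hσu] with θ hθ
    exact (measure_mono ((preimage_mono inter_subset_right).trans (hsec θ hθ))).trans_lt (by simp)

/-- the section volume CDF of a strictly convex body is absolutely
continuous with respect to Lebesgue measure. -/
theorem sectionCDF_absolutelyContinuous_of_strictlyConvex {n : ℕ} (hn : 2 ≤ n)
    (K : Set (Euc n)) (hK : IsStrictlyConvexBody K) :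
    IsAbsolutelyContinuousCDF (sectionCDF K) := by
  obtain ⟨d, rfl⟩ : ∃ d, n = d + 1 := ⟨n - 1, by omega⟩
  exact main_aux (by omega) K hK
end
end
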